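/- Let θ > 0, α ∈ (0,1], and φ ∈ C^{2,α}([−1,1]). Let {u_t}_{t∈[−1,1]} be a family of functions, continuous on the closed ball B̄₂ ⊂ ℝ², each solving the two-phase thin obstacle problem in B₂: u_t is even in x₂, harmonic in B₂ ∖ {x₂ = 0}, for every x₁ with (x₁,0) ∈ B₂ the one-sided derivative ∂₂u_t(x₁,0⁺) := lim_{s→0⁺}(u_t(x₁,s) − u_t(x₁,0))/s exists, ∂₂u_t(x₁,0⁺) = θ for |x₁| > 1, |∂₂u_t(x₁,0⁺)| ≤ θ for |x₁| ≤ 1, and ∂₂u_t(x₁,0⁺) = θ·sign(u_t(x₁,0) − φ(x₁)) for x₁ ∈ [−1,1] with u_t(x₁,0) ≠ φ(x₁). Assume the map t ↦ u_t is continuous with respect to uniform convergence on B̄₂ and that there exists η > 0 such that, for all −1 ≤ t < t+ε ≤ 1, u_{t+ε} ≥ u_t on ∂B₂ and u_{t+ε} ≥ u_t + ηε on ∂B₂ ∩ {|x₂| > 1}. Then for Lebesgue-almost every t ∈ [−1,1]: (i) u_t has no singular points; (ii) the topological boundary in ℝ of the set {x₁ ∈ [−1,1] : u_t(x₁,0)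 ≠ φ(x₁)} is a finite set. -/

import Mathlib

open MeasureTheory Set

/-- Laplacian of a function on `ℝ²`, computed through iterated coordinate derivatives. -/
noncomputable def lap2 (u : ℝ × ℝ → ℝ) (p : ℝ × ℝ) : ℝ :=
  deriv (deriv (fun t => u (t, p.2))) p.1 + deriv (deriv (fun t => u (p.1, t))) p.2

/-- `u` is harmonic on the open set `U ⊆ ℝ²`: it is `C²` there and its Laplacian vanishes. -/
def HarmonicOn2 (u : ℝ × ℝ → ℝ) (U : Set (ℝ × ℝ)) : Prop :=
  ContDiffOn ℝ 2 u U ∧ ∀ p ∈ U, lap2 u p = 0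

/-- `x₀` is a singular point of the solution `u` of the two-phase thin obstacle problem
with slope `θ` and obstacle `φ`: a contact point which either is an endpoint `±1`, or near
which `u(·,0)` stays on one side of `φ` and `u ∓ θ|x₂|` detaches from the obstacle at most
quadratically. -/
def SingPt (θ : ℝ) (φ : ℝ → ℝ) (u : ℝ × ℝ → ℝ) (x₀ : ℝ) : Prop :=
  x₀ ∈ Set.Icc (-1:ℝ) 1 ∧ u (x₀, 0) = φ x₀ ∧
  (x₀ = -1 ∨ x₀ = 1 ∨
    ∃ ρ > 0, Set.Ioo (x₀ - ρ) (x₀ + ρ) ⊆ Set.Ioo (-1:ℝ) 1 ∧ ∃ C > 0,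
      ((∀ x₁ ∈ Set.Ioo (x₀ - ρ) (x₀ + ρ), φ x₁ ≤ u (x₁, 0)) ∧
        ∀ r ∈ Set.Ioo (0:ℝ) ρ, ∀ p : ℝ × ℝ, (p.1 - x₀)^2 + p.2^2 < r^2 →
          |u p - θ * |p.2| - φ p.1| ≤ C * r^2) ∨
      ((∀ x₁ ∈ Set.Ioo (x₀ - ρ) (x₀ + ρ), u (x₁, 0) ≤ φ x₁) ∧
        ∀ r ∈ Set.Ioo (0:ℝ) ρ, ∀ p : ℝ × ℝ, (p.1 - x₀)^2 + p.2^2 < r^2 →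
          |u p + θ * |p.2| - φ p.1| ≤ C * r^2))

open Filter Topology

/-- `f` is differentiable near `x` and its derivative has derivative `a` at `x`. -/
def HasSecondDerivAt (f : ℝ → ℝ) (a x : ℝ) : Prop :=
  ∃ f' : ℝ → ℝ, (∀ᶠ s in 𝓝 x, HasDerivAt f (f' s) s) ∧ HasDerivAt f' a x

namespace HasSecondDerivAt

variable {f g : ℝ → ℝ} {a b x : ℝ}

theorem add (hf : HasSecondDerivAt f a x) (hg : HasSecondDerivAt g b x) :
    HasSecondDerivAt (fun s => f s + g s) (a + b) x := by
  obtain ⟨f', hf, hf'⟩ := hf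
  obtain ⟨g', hg, hg'⟩ := hg
  refine ⟨fun s => f' s + g' s, ?_, hf'.add hg'⟩
  filter_upwards [hf, hg] with s h1 h2 using h1.add h2

theorem const_mul (c : ℝ) (hf : HasSecondDerivAt f a x) :
    HasSecondDerivAt (fun s => c * f s) (c * a) x := by
  obtain ⟨f', hf, hf'⟩ := hf
  refine ⟨fun s => c * f' s, ?_, hf'.const_mul c⟩
  filter_upwards [hf] with s h1 using h1.const_mul c

theorem comp_affine {σ c : ℝ} (hf : HasSecondDerivAt f a (σ * x + c)) :
    HasSecondDerivAt (fun s => f (σ * s + c)) (σ ^ 2 * a) x := by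
  obtain ⟨f', hf, hf'⟩ := hf
  have haff : ∀ s, HasDerivAt (fun s : ℝ => σ * s + c) σ s := fun s => by
    simpa using ((hasDerivAt_id s).const_mul σ).add_const c
  refine ⟨fun s => f' (σ * s + c) * σ, ?_, ?_⟩
  · filter_upwards [(haff x).continuousAt.eventually hf] with s h1
    exact h1.comp s (haff s)
  · exact ((hf'.comp x (haff x)).mul_const σ).congr_deriv (by ring)

theorem nonneg_of_isLocalMin (hf : HasSecondDerivAt f a x) (hmin : IsLocalMin f x) : 0 ≤ a := by
  by_contra! ha
  obtain ⟨f', hf, hf'⟩ := hf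
  have hderiv : deriv f =ᶠ[𝓝 x] f' := by
    filter_upwards [hf] with s h using h.deriv
  have h2 : deriv (deriv f) x = a := by rw [hderiv.deriv_eq, hf'.deriv]
  have hmax := isLocalMax_of_deriv_deriv_neg (h2 ▸ ha) hmin.deriv_eq_zero
    hf.self_of_nhds.continuousAt
  have hconst : f =ᶠ[𝓝 x] fun _ => f x := by
    filter_upwards [hmin, hmax] with s h3 h4 using le_antisymm h4 h3
  have h0 : deriv f =ᶠ[𝓝 x] fun _ => 0 := by
    filter_upwards [hconst.eventuallyEq_nhds] with s hs
    rw [hs.deriv_eq, deriv_const]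
  rw [h0.deriv_eq, deriv_const] at h2
  exact ha.ne h2.symm

end HasSecondDerivAt

/-- The Laplacian of `g` at `p` exists, as a sum of two second partial derivatives, and equals
`ℓ`. -/
def HasLaplacianAt (g : ℝ × ℝ → ℝ) (ℓ : ℝ) (p : ℝ × ℝ) : Prop :=
  ∃ a b, HasSecondDerivAt (fun s => g (s, p.2)) a p.1 ∧
    HasSecondDerivAt (fun s => g (p.1, s)) b p.2 ∧ a + b = ℓ

namespace HasLaplacianAt

variable {f g : ℝ × ℝ → ℝ} {k ℓ : ℝ} {p : ℝ × ℝ}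

theorem add (hf : HasLaplacianAt f k p) (hg : HasLaplacianAt g ℓ p) :
    HasLaplacianAt (fun q => f q + g q) (k + ℓ) p := by
  obtain ⟨a, b, h1, h2, rfl⟩ := hf
  obtain ⟨c, d, h3, h4, rfl⟩ := hg
  exact ⟨a + c, b + d, h1.add h3, h2.add h4, by ring⟩

theorem const_mul (c : ℝ) (hf : HasLaplacianAt f k p) :
    HasLaplacianAt (fun q => c * f q) (c * k) p := by
  obtain ⟨a, b, h1, h2, rfl⟩ := hf
  exact ⟨c * a, c * b, h1.const_mul c, h2.const_mul c, by ring⟩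

theorem neg (hf : HasLaplacianAt f k p) : HasLaplacianAt (fun q => -f q) (-k) p := by
  simpa using hf.const_mul (-1)

theorem sub (hf : HasLaplacianAt f k p) (hg : HasLaplacianAt g ℓ p) :
    HasLaplacianAt (fun q => f q - g q) (k - ℓ) p := by
  simpa [sub_eq_add_neg] using hf.add hg.neg

theorem congr_laplacian (hf : HasLaplacianAt f k p) (h : k = ℓ) : HasLaplacianAt f ℓ p := h ▸ hf

theorem comp_affine_fst {σ c x y : ℝ} (hσ : σ ^ 2 = 1) (hf : HasLaplacianAt f k (σ * x + c, y)) :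
    HasLaplacianAt (fun q => f (σ * q.1 + c, q.2)) k (x, y) := by
  obtain ⟨a, b, h1, h2, rfl⟩ := hf
  refine ⟨a, b, ?_, h2, rfl⟩
  have h1' : HasSecondDerivAt (fun s => f (s, y)) a (σ * x + c) := h1
  simpa [hσ] using h1'.comp_affine

theorem re_comp {F F' : ℂ → ℂ} {a : ℂ}
    (hF : ∀ᶠ z in 𝓝 (p.1 + p.2 * Complex.I : ℂ), HasDerivAt F (F' z) z)
    (hF' : HasDerivAt F' a (p.1 + p.2 * Complex.I)) :
    HasLaplacianAt (fun q => (F (q.1 + q.2 * Complex.I)).re) 0 p := by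
  have hx : ∀ s : ℝ, HasDerivAt (fun s : ℝ => (s + p.2 * Complex.I : ℂ)) 1 s := fun s => by
    simpa using (Complex.ofRealCLM.hasDerivAt (x := s)).add_const (p.2 * Complex.I : ℂ)
  have hy : ∀ s : ℝ, HasDerivAt (fun s : ℝ => (p.1 + s * Complex.I : ℂ)) Complex.I s := fun s => by
    simpa using ((Complex.ofRealCLM.hasDerivAt (x := s)).mul_const Complex.I).const_add (p.1 : ℂ)
  have hre : ∀ {G : ℝ → ℂ} {b : ℂ} {s : ℝ}, HasDerivAt G b s →
      HasDerivAt (fun s => (G s).re) b.re s := fun {G b s} h => by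
    exact Complex.reCLM.hasFDerivAt.comp_hasDerivAt s h
  refine ⟨a.re, (a * Complex.I * Complex.I).re, ⟨fun s => (F' (s + p.2 * Complex.I)).re, ?_, ?_⟩,
    ⟨fun s => (F' (p.1 + s * Complex.I) * Complex.I).re, ?_, ?_⟩, ?_⟩
  · filter_upwards [(hx p.1).continuousAt.eventually hF] with s hs
    simpa using hre (hs.comp s (hx s))
  · simpa using hre (hF'.comp p.1 (hx p.1))
  · filter_upwards [(hy p.2).continuousAt.eventually hF] with s hs
    exact hre (hs.comp s (hy s))
  · exact hre ((hF'.comp p.2 (hy p.2)).mul_const Complex.I)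
  · simp [mul_assoc]

end HasLaplacianAt

/-- The one-sided vertical derivative of `g` at `(x, 0)` from above exists and equals `L`. -/
def HasNormalDeriv (g : ℝ × ℝ → ℝ) (L x : ℝ) : Prop :=
  Tendsto (fun s => (g (x, s) - g (x, 0)) / s) (𝓝[>] 0) (𝓝 L)

namespace HasNormalDeriv

variable {f g : ℝ × ℝ → ℝ} {K L x : ℝ}

theorem add (hf : HasNormalDeriv f K x) (hg : HasNormalDeriv g L x) :
    HasNormalDeriv (fun q => f q + g q) (K + L) x := by
  refine (Tendsto.add hf hg).congr fun s => ?_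
  ring

theorem const_mul (c : ℝ) (hf : HasNormalDeriv f K x) :
    HasNormalDeriv (fun q => c * f q) (c * K) x := by
  refine (Tendsto.const_mul c hf).congr fun s => ?_
  ring

theorem neg (hf : HasNormalDeriv f K x) : HasNormalDeriv (fun q => -f q) (-K) x := by
  simpa using hf.const_mul (-1)

theorem sub (hf : HasNormalDeriv f K x) (hg : HasNormalDeriv g L x) :
    HasNormalDeriv (fun q => f q - g q) (K - L) x := by
  simpa [sub_eq_add_neg] using hf.add hg.neg

theorem comp_affine_fst {σ c : ℝ} (hf : HasNormalDeriv f K (σ * x + c)) :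
    HasNormalDeriv (fun q => f (σ * q.1 + c, q.2)) K x := hf

theorem of_hasDerivAt (h : HasDerivAt (fun s => g (x, s)) L 0) : HasNormalDeriv g L x := by
  have := (hasDerivAt_iff_tendsto_slope.1 h).mono_left
    (nhdsWithin_mono 0 (fun s (hs : 0 < s) => hs.ne'))
  refine this.congr fun s => ?_
  simp [slope_def_field]

end HasNormalDeriv

/-- Minimum principle on a compact subset of the closed upper half plane: a continuous function
is nonnegative if every point where it is negative is either an interior point where it is
superharmonic, or a point of the line `{x₂ = 0}` with nonpositive normal derivative. -/
theorem nonneg_of_superharmonic {D : Set (ℝ × ℝ)} {g : ℝ × ℝ → ℝ} (hD : IsCompact D)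
    (hg : ContinuousOn g D)
    (H : ∀ p ∈ D, g p < 0 →
      (D ∈ 𝓝 p ∧ ∃ ℓ ≤ 0, HasLaplacianAt g ℓ p) ∨
      (p.2 = 0 ∧ (∀ᶠ s in 𝓝[>] (0 : ℝ), (p.1, s) ∈ D) ∧ ∃ L ≤ 0, HasNormalDeriv g L p.1)) :
    ∀ p ∈ D, 0 ≤ g p := by
  by_contra! hcon
  obtain ⟨q, hq, hgq⟩ := hcon
  obtain ⟨C, hC⟩ := hD.bddAbove_image
    (f := fun p : ℝ × ℝ => p.2 + p.2 ^ 2) (by fun_prop)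
  have hC' : ∀ p ∈ D, p.2 + p.2 ^ 2 ≤ |C| + 1 := fun p hp =>
    (hC ⟨p, hp, rfl⟩).trans (by linarith [le_abs_self C])
  set A := |C| + 1 with hA
  have hden : 0 < A - (q.2 + q.2 ^ 2) + 2 := by linarith [hC' q hq]
  set ε := -g q / (A - (q.2 + q.2 ^ 2) + 2) / 2 with hε
  have hεpos : 0 < ε := by
    have : 0 < -g q := by linarith
    positivity
  have hεq : ε * (A - (q.2 + q.2 ^ 2) + 2) = -g q / 2 := by
    rw [hε, div_div, mul_comm, mul_div_assoc', mul_comm, mul_comm _ (2 : ℝ),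
      mul_div_mul_right _ _ hden.ne']
  set G : ℝ × ℝ → ℝ := fun p => g p + ε * (A + (-1 * p.2 + -1 * p.2 ^ 2)) with hG
  obtain ⟨p, hp, hmin⟩ := hD.exists_isMinOn ⟨q, hq⟩ (f := G) (hg.add (by fun_prop))
  have hGp : G p < 0 := by
    refine lt_of_le_of_lt (hmin hq) ?_
    simp only [hG]
    nlinarith
  have hgp : g p < 0 := by
    have h1 : 0 ≤ ε * (A + (-1 * p.2 + -1 * p.2 ^ 2)) :=
      mul_nonneg hεpos.le (by linarith [hC' p hp])
    simp only [hG] at hGp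
    linarith
  have hpoly : ∀ s : ℝ, HasDerivAt (fun s : ℝ => ε * (A + (-1 * s + -1 * s ^ 2)))
      (ε * (-1 - 2 * s)) s := fun s => by
    have := ((((hasDerivAt_id s).const_mul (-1)).add
      ((hasDerivAt_pow 2 s).const_mul (-1))).const_add A).const_mul ε
    refine this.congr_deriv ?_
    push_cast
    ring
  rcases H p hp hgp with ⟨hDp, ℓ, hℓ, a, b, ha, hb, rfl⟩ | ⟨hp0, hev, L, hL, hnor⟩
  · have hloc : IsLocalMin G p := hmin.isLocalMin hDp
    have hl1 : IsLocalMin (fun s => G (s, p.2)) p.1 := by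
      have : ContinuousAt (fun s : ℝ => (s, p.2)) p.1 := by fun_prop
      exact this.eventually hloc
    have hl2 : IsLocalMin (fun s => G (p.1, s)) p.2 := by
      have : ContinuousAt (fun s : ℝ => (p.1, s)) p.2 := by fun_prop
      exact this.eventually hloc
    have hc : HasSecondDerivAt (fun _ : ℝ => ε * (A + (-1 * p.2 + -1 * p.2 ^ 2))) 0 p.1 :=
      ⟨fun _ => 0, Eventually.of_forall fun s => hasDerivAt_const _ _, hasDerivAt_const _ _⟩
    have hd : HasSecondDerivAt (fun s : ℝ => ε * (A + (-1 * s + -1 * s ^ 2))) (ε * -2) p.2 := by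
      refine ⟨fun s => ε * (-1 - 2 * s), Eventually.of_forall hpoly, ?_⟩
      have := (((hasDerivAt_id p.2).const_mul 2).const_sub (-1)).const_mul ε
      simpa using this
    have h1 := (ha.add hc).nonneg_of_isLocalMin hl1
    have h2 := (hb.add hd).nonneg_of_isLocalMin hl2
    linarith
  · have hnorG : HasNormalDeriv G (L + ε * (-1 - 2 * 0)) p.1 :=
      hnor.add (HasNormalDeriv.of_hasDerivAt
        (g := fun q => ε * (A + (-1 * q.2 + -1 * q.2 ^ 2))) (hpoly 0))
    have hge : 0 ≤ L + ε * (-1 - 2 * 0) := by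
      refine ge_of_tendsto hnorG ?_
      filter_upwards [hev, self_mem_nhdsWithin] with s hs hs0
      have hle : G p ≤ G (p.1, s) := hmin hs
      have hpe : p = (p.1, 0) := Prod.ext rfl hp0
      rw [hpe] at hle
      exact div_nonneg (sub_nonneg.2 hle) (le_of_lt hs0)
    linarith

theorem hasDerivAt_cubic (A B C D s : ℝ) :
    HasDerivAt (fun s : ℝ => A + B * s + C * s ^ 2 + D * s ^ 3)
      (B + 2 * C * s + 3 * D * s ^ 2) s := by
  have := ((((hasDerivAt_id s).const_mul B).const_add A).add
    ((hasDerivAt_pow 2 s).const_mul C)).add ((hasDerivAt_pow 3 s).const_mul D)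
  refine this.congr_deriv ?_
  push_cast
  ring

theorem HasSecondDerivAt.of_cubic {g : ℝ → ℝ} {x : ℝ} (A B C D : ℝ)
    (h : ∀ s, g s = A + B * s + C * s ^ 2 + D * s ^ 3) :
    HasSecondDerivAt g (2 * C + 6 * D * x) x := by
  obtain rfl : g = _ := funext h
  refine ⟨_, Eventually.of_forall (hasDerivAt_cubic A B C D), ?_⟩
  have := hasDerivAt_cubic B (2 * C) (3 * D) 0 x
  simp only [zero_mul, add_zero] at this
  exact this.congr_deriv (by ring)

theorem HasNormalDeriv.of_cubic {g : ℝ × ℝ → ℝ} {x : ℝ} (A B C D : ℝ)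
    (h : ∀ s, g (x, s) = A + B * s + C * s ^ 2 + D * s ^ 3) : HasNormalDeriv g B x := by
  refine HasNormalDeriv.of_hasDerivAt ?_
  obtain h' : (fun s => g (x, s)) = _ := funext h
  rw [h']
  exact (hasDerivAt_cubic A B C D 0).congr_deriv (by ring)

theorem isBounded_of_abs_le {D : Set (ℝ × ℝ)} (R : ℝ) (h : ∀ p ∈ D, |p.1| ≤ R ∧ |p.2| ≤ R) :
    Bornology.IsBounded D := by
  refine isBounded_iff_forall_norm_le.2 ⟨R, fun p hp => ?_⟩
  rw [Prod.norm_def, Real.norm_eq_abs, Real.norm_eq_abs]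
  exact max_le (h p hp).1 (h p hp).2

/-- Minimum principle on the region `{A ≤ 0} ∩ {0 ≤ x₂}`. -/
theorem nonneg_of_superharmonic_region {A g : ℝ × ℝ → ℝ} (hA : Continuous A) (R : ℝ)
    (hR : ∀ p, A p ≤ 0 → 0 ≤ p.2 → |p.1| ≤ R ∧ |p.2| ≤ R)
    (hg : ContinuousOn g {p | A p ≤ 0 ∧ 0 ≤ p.2})
    (hbd : ∀ p, A p = 0 → 0 ≤ p.2 → 0 ≤ g p)
    (hinterior : ∀ p, A p < 0 → 0 < p.2 → ∃ ℓ ≤ 0, HasLaplacianAt g ℓ p)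
    (hline : ∀ x, A (x, 0) < 0 → g (x, 0) < 0 → ∃ L ≤ 0, HasNormalDeriv g L x) :
    ∀ p, A p ≤ 0 → 0 ≤ p.2 → 0 ≤ g p := by
  have hcl : IsClosed {p : ℝ × ℝ | A p ≤ 0 ∧ 0 ≤ p.2} :=
    (isClosed_le hA continuous_const).inter (isClosed_le continuous_const continuous_snd)
  have hcpt := Metric.isCompact_of_isClosed_isBounded hcl
    (isBounded_of_abs_le R fun p hp => hR p hp.1 hp.2)
  intro p hp hp2
  refine nonneg_of_superharmonic hcpt hg ?_ p ⟨hp, hp2⟩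
  rintro q ⟨hq, hq2⟩ hgq
  have hq' : A q < 0 := lt_of_le_of_ne hq fun h => (hbd q h hq2).not_gt hgq
  rcases hq2.eq_or_lt with h0 | h0
  · right
    have hqe : q = (q.1, 0) := Prod.ext rfl h0.symm
    refine ⟨h0.symm, ?_, hline q.1 (hqe ▸ hq') (hqe ▸ hgq)⟩
    have hc : ContinuousAt (fun s : ℝ => A (q.1, s)) 0 := by fun_prop
    have hlt : A (q.1, 0) < 0 := hqe ▸ hq'
    filter_upwards [nhdsWithin_le_nhds (hc.eventually_lt_const hlt), self_mem_nhdsWithin]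
      with s h1 h2 using ⟨h1.le, le_of_lt h2⟩
  · left
    refine ⟨?_, hinterior q hq' h0⟩
    filter_upwards [hA.continuousAt.eventually_lt_const hq',
      continuous_snd.continuousAt.eventually_const_lt h0] with s h1 h2 using ⟨h1.le, h2.le⟩

/-- Solutions, on the closed upper half disc of radius `2`, of the two-phase thin obstacle
problem with obstacle `φ` on `[-1,1]` and Neumann datum `κ` on the rest of the line. -/
structure IsThinSolution (θ κ : ℝ) (φ : ℝ → ℝ) (u : ℝ × ℝ → ℝ) : Prop where
  continuousOn : ContinuousOn u {p : ℝ × ℝ | p.1 ^ 2 + p.2 ^ 2 ≤ 4 ∧ 0 ≤ p.2}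
  laplacian : ∀ p : ℝ × ℝ, p.1 ^ 2 + p.2 ^ 2 < 4 → 0 < p.2 → HasLaplacianAt u 0 p
  normalDeriv : ∀ x : ℝ, x ^ 2 < 4 → ∃ L : ℝ, HasNormalDeriv u L x ∧ (1 < |x| → L = κ) ∧
    (|x| ≤ 1 → |L| ≤ θ ∧ (φ x < u (x, 0) → L = θ) ∧ (u (x, 0) < φ x → L = -θ))

theorem IsThinSolution.neg {θ κ : ℝ} {φ : ℝ → ℝ} {u : ℝ × ℝ → ℝ} (h : IsThinSolution θ κ φ u) :
    IsThinSolution θ (-κ) (fun x => -φ x) (fun p => -u p) where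
  continuousOn := h.continuousOn.neg
  laplacian p hp hp2 := by simpa using (h.laplacian p hp hp2).neg
  normalDeriv x hx := by
    obtain ⟨L, h1, h2, h3⟩ := h.normalDeriv x hx
    refine ⟨-L, h1.neg, fun h => by rw [h2 h], fun h => ?_⟩
    obtain ⟨h4, h5, h6⟩ := h3 h
    refine ⟨by rwa [abs_neg], fun h => ?_, fun h => ?_⟩
    · rw [h6 (neg_lt_neg_iff.1 h), neg_neg]
    · rw [h5 (neg_lt_neg_iff.1 h)]

/-- A strictly increasing family of solutions of the two-phase thin obstacle problem. -/
structure IsThinFamily (θ κ η : ℝ) (φ : ℝ → ℝ) (u : ℝ → ℝ × ℝ → ℝ) : Prop where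
  θ_pos : 0 < θ
  η_pos : 0 < η
  sol : ∀ t ∈ Icc (-1 : ℝ) 1, IsThinSolution θ κ φ (u t)
  mono : ∀ t ∈ Icc (-1 : ℝ) 1, ∀ t' ∈ Icc (-1 : ℝ) 1, t < t' →
    ∀ p : ℝ × ℝ, p.1 ^ 2 + p.2 ^ 2 = 4 → 0 ≤ p.2 →
      (u t p ≤ u t' p ∧ (1 < p.2 → u t p + η * (t' - t) ≤ u t' p))

namespace IsThinFamily

variable {θ κ η : ℝ} {φ : ℝ → ℝ} {u : ℝ → ℝ × ℝ → ℝ}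

theorem neg (h : IsThinFamily θ κ η φ u) :
    IsThinFamily θ (-κ) η (fun x => -φ x) (fun t p => -u (-t) p) where
  θ_pos := h.θ_pos
  η_pos := h.η_pos
  sol t ht := (h.sol (-t) ⟨by linarith [ht.2], by linarith [ht.1]⟩).neg
  mono t ht t' ht' htt p hp hp2 := by
    have := h.mono (-t') ⟨by linarith [ht'.2], by linarith [ht'.1]⟩ (-t)
      ⟨by linarith [ht.2], by linarith [ht.1]⟩ (by linarith) p hp hp2
    refine ⟨by linarith [this.1], fun h1 => ?_⟩
    have := this.2 h1
    linarith

theorem le_of_le (h : IsThinFamily θ κ η φ u) {t t' : ℝ} (ht : t ∈ Icc (-1 : ℝ) 1)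
    (ht' : t' ∈ Icc (-1 : ℝ) 1) (htt : t ≤ t') {p : ℝ × ℝ} (hp : p.1 ^ 2 + p.2 ^ 2 ≤ 4)
    (hp2 : 0 ≤ p.2) : u t p ≤ u t' p := by
  rcases htt.eq_or_lt with rfl | htt
  · rfl
  have key := nonneg_of_superharmonic_region (A := fun p : ℝ × ℝ => p.1 ^ 2 + p.2 ^ 2 - 4)
    (g := fun p => u t' p - u t p) (by fun_prop) 2
    (fun p hp _ => ⟨abs_le_of_sq_le_sq (by nlinarith) (by norm_num),
      abs_le_of_sq_le_sq (by nlinarith) (by norm_num)⟩)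
    (by simp only [sub_nonpos]; exact (h.sol t' ht').continuousOn.sub (h.sol t ht).continuousOn)
    (fun p hp hp2 => sub_nonneg.2 (h.mono t ht t' ht' htt p (by linarith) hp2).1)
    (fun p hp hp2 => ⟨0, le_rfl, by
      simpa using ((h.sol t' ht').laplacian p (by linarith) hp2).sub
        ((h.sol t ht).laplacian p (by linarith) hp2)⟩) ?_ p (by simpa using hp) hp2
  · linarith
  intro x hx hneg
  have hx4 : x ^ 2 < 4 := by simp at hx; linarith
  obtain ⟨L, h1, h2, h3⟩ := (h.sol t ht).normalDeriv x hx4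
  obtain ⟨L', h1', h2', h3'⟩ := (h.sol t' ht').normalDeriv x hx4
  refine ⟨L' - L, ?_, h1'.sub h1⟩
  rcases lt_or_ge 1 |x| with hx1 | hx1
  · rw [h2 hx1, h2' hx1, sub_self]
  · obtain ⟨h4, h5, h6⟩ := h3 hx1
    obtain ⟨h4', h5', h6'⟩ := h3' hx1
    rcases lt_or_ge (u t' (x, 0)) (φ x) with h7 | h7
    · rw [h6' h7]; linarith [(abs_le.1 h4).1]
    · rw [h5 (by linarith)]; linarith [(abs_le.1 h4').2]

/-- Linear growth in the vertical direction of the difference of two members of the family. -/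
theorem lower_bound (h : IsThinFamily θ κ η φ u) {t t' : ℝ} (ht : t ∈ Icc (-1 : ℝ) 1)
    (ht' : t' ∈ Icc (-1 : ℝ) 1) (htt : t ≤ t') {p : ℝ × ℝ} (hp : p.1 ^ 2 + p.2 ^ 2 ≤ 4)
    (hp2 : 0 ≤ p.2) (hp1 : |p.1| ≤ 3 / 2) :
    η / 24 * (t' - t) * p.2 ≤ u t' p - u t p := by
  rcases htt.eq_or_lt with rfl | htt
  · simp
  set m := η / 24 * (t' - t) with hm
  have hm0 : 0 < m := mul_pos (by linarith [h.η_pos]) (by linarith)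
  have hmono : ∀ q : ℝ × ℝ, q.1 ^ 2 + q.2 ^ 2 ≤ 4 → 0 ≤ q.2 → u t q ≤ u t' q := fun q h1 h2 =>
    h.le_of_le ht ht' htt.le h1 h2
  have key := nonneg_of_superharmonic_region (A := fun p : ℝ × ℝ => p.1 ^ 2 + p.2 ^ 2 - 4)
    (g := fun p => u t' p - u t p - m * (p.2 * (8 - 3 * p.1 ^ 2 + p.2 ^ 2))) (by fun_prop) 2
    (fun p hp _ => ⟨abs_le_of_sq_le_sq (by nlinarith) (by norm_num),
      abs_le_of_sq_le_sq (by nlinarith) (by norm_num)⟩)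
    (by
      refine ContinuousOn.sub ?_ (by fun_prop)
      simp only [sub_nonpos]
      exact (h.sol t' ht').continuousOn.sub (h.sol t ht).continuousOn)
    ?_ ?_ ?_ p (by simpa using hp) hp2
  · have h1 : p.1 ^ 2 ≤ 9 / 4 := by nlinarith [abs_nonneg p.1, sq_abs p.1]
    have h2 : m * p.2 * 1 ≤ m * p.2 * (8 - 3 * p.1 ^ 2 + p.2 ^ 2) :=
      mul_le_mul_of_nonneg_left (by nlinarith) (by positivity)
    linarith
  · intro q hq hq2
    have hq4 : q.1 ^ 2 + q.2 ^ 2 = 4 := by linarith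
    have h0 := h.mono t ht t' ht' htt q hq4 hq2
    have hq1 : 8 - 3 * q.1 ^ 2 + q.2 ^ 2 = 4 * (q.2 ^ 2 - 1) := by linarith
    have hq3 : q.2 ≤ 2 := by nlinarith [sq_nonneg q.1]
    show 0 ≤ u t' q - u t q - m * (q.2 * (8 - 3 * q.1 ^ 2 + q.2 ^ 2))
    rw [hq1]
    rcases lt_or_ge 1 q.2 with h1 | h1
    · have h2 : q.2 * (4 * (q.2 ^ 2 - 1)) ≤ 24 := by nlinarith
      have h3 := mul_le_mul_of_nonneg_left h2 hm0.le
      have h4 : m * 24 = η * (t' - t) := by rw [hm]; ring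
      linarith [h0.2 h1]
    · have h2 : q.2 * (4 * (q.2 ^ 2 - 1)) ≤ 0 := by nlinarith
      nlinarith [h0.1]
  · intro q hq hq2
    refine ⟨_, le_of_eq ?_, (((h.sol t' ht').laplacian q (by linarith) hq2).sub
        ((h.sol t ht).laplacian q (by linarith) hq2)).sub (HasLaplacianAt.const_mul m
        ⟨_, _, HasSecondDerivAt.of_cubic (q.2 * (8 + q.2 ^ 2)) 0 (-3 * q.2) 0 (fun s => by ring),
          HasSecondDerivAt.of_cubic 0 (8 - 3 * q.1 ^ 2) 0 1 (fun s => by ring), rfl⟩)⟩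
    ring
  · intro x hx hneg
    simp at hx hneg
    have := hmono (x, 0) (by simp; linarith) le_rfl
    linarith

theorem exists_bound (h : IsThinFamily θ κ η φ u) : ∃ M > 0, ∀ t ∈ Icc (-1 : ℝ) 1,
    ∀ p : ℝ × ℝ, p.1 ^ 2 + p.2 ^ 2 ≤ 4 → 0 ≤ p.2 → |u t p| ≤ M := by
  have hcl : IsClosed {p : ℝ × ℝ | p.1 ^ 2 + p.2 ^ 2 ≤ 4 ∧ 0 ≤ p.2} :=
    (isClosed_le (f := fun p : ℝ × ℝ => p.1 ^ 2 + p.2 ^ 2) (by fun_prop) continuous_const).inter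
      (isClosed_le continuous_const continuous_snd)
  have hcpt := Metric.isCompact_of_isClosed_isBounded hcl (isBounded_of_abs_le 2 fun p hp =>
    ⟨abs_le_of_sq_le_sq (by nlinarith [hp.1]) (by norm_num),
      abs_le_of_sq_le_sq (by nlinarith [hp.1]) (by norm_num)⟩)
  have hm : (-1 : ℝ) ∈ Icc (-1 : ℝ) 1 := by norm_num
  have hp : (1 : ℝ) ∈ Icc (-1 : ℝ) 1 := by norm_num
  obtain ⟨M₁, h1⟩ := hcpt.exists_bound_of_continuousOn (h.sol _ hm).continuousOn
  obtain ⟨M₂, h2⟩ := hcpt.exists_bound_of_continuousOn (h.sol _ hp).continuousOn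
  refine ⟨|M₁| + |M₂| + 1, by positivity, fun t ht p hp4 hp0 => abs_le.2 ⟨?_, ?_⟩⟩
  · have := h.le_of_le hm ht ht.1 hp4 hp0
    have h3 := (abs_le.1 (h1 p ⟨hp4, hp0⟩)).1
    linarith [le_abs_self M₁, abs_nonneg M₂]
  · have := h.le_of_le ht hp ht.2 hp4 hp0
    have h3 := (abs_le.1 (h2 p ⟨hp4, hp0⟩)).2
    linarith [le_abs_self M₂, abs_nonneg M₁]

end IsThinFamily

theorem HasNormalDeriv.of_even {g : ℝ × ℝ → ℝ} {x : ℝ}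
    (hd : DifferentiableAt ℝ (fun s => g (x, s)) 0) (he : ∀ s, g (x, -s) = g (x, s)) :
    HasNormalDeriv g 0 x := by
  have h1 := hd.hasDerivAt
  have h1' : HasDerivAt (fun s => g (x, s)) (deriv (fun s => g (x, s)) 0) (-0) := by simpa using h1
  have h2 : HasDerivAt (fun s => g (x, s)) (deriv (fun s => g (x, s)) 0 * (-1)) 0 :=
    (h1'.comp (0 : ℝ) (hasDerivAt_neg 0)).congr_of_eventuallyEq
      (Eventually.of_forall fun s => (he s).symm)
  have h3 := h1.unique h2
  have h4 : deriv (fun s => g (x, s)) 0 = 0 := by linarith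
  exact HasNormalDeriv.of_hasDerivAt (h1.congr_deriv h4)

/-- The real part of the principal square root of `p.1 + i p.2`. -/
noncomputable def reSqrt (p : ℝ × ℝ) : ℝ := √((√(p.1 ^ 2 + p.2 ^ 2) + p.1) / 2)

theorem abs_fst_le_sqrt (p : ℝ × ℝ) : |p.1| ≤ √(p.1 ^ 2 + p.2 ^ 2) :=
  Real.abs_le_sqrt (by nlinarith [sq_nonneg p.2])

theorem continuous_reSqrt : Continuous reSqrt := by
  unfold reSqrt
  fun_prop

theorem reSqrt_nonneg (p : ℝ × ℝ) : 0 ≤ reSqrt p := Real.sqrt_nonneg _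

theorem reSqrt_sq (p : ℝ × ℝ) : reSqrt p ^ 2 = (√(p.1 ^ 2 + p.2 ^ 2) + p.1) / 2 :=
  Real.sq_sqrt (by linarith [neg_abs_le p.1, abs_fst_le_sqrt p])

theorem reSqrt_of_nonpos {x : ℝ} (hx : x ≤ 0) : reSqrt (x, 0) = 0 := by
  simp [reSqrt, Real.sqrt_sq_eq_abs, abs_of_nonpos hx]

theorem reSqrt_le {p : ℝ × ℝ} {ρ : ℝ} (hρ : 0 ≤ ρ) (hp : p.1 ^ 2 + p.2 ^ 2 ≤ ρ ^ 2) :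
    reSqrt p ≤ √ρ := by
  have h1 : √(p.1 ^ 2 + p.2 ^ 2) ≤ ρ := Real.sqrt_le_iff.2 ⟨hρ, hp⟩
  exact Real.sqrt_le_sqrt (by linarith [le_abs_self p.1, abs_fst_le_sqrt p])

theorem re_cpow_half (z : ℂ) : (z ^ (2⁻¹ : ℂ)).re = reSqrt (z.re, z.im) := by
  have hsq : (z ^ (2⁻¹ : ℂ)) ^ 2 = z := by
    simp
  set ζ := z ^ (2⁻¹ : ℂ) with hζ
  have hre : 0 ≤ ζ.re := by
    rcases eq_or_ne z 0 with rfl | hz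
    · simp [hζ]
    rw [hζ, Complex.cpow_def_of_ne_zero hz, Complex.exp_re]
    refine mul_nonneg (Real.exp_nonneg _) (Real.cos_nonneg_of_mem_Icc ?_)
    have him : (Complex.log z * 2⁻¹).im = z.arg / 2 := by
      have h2 : (2⁻¹ : ℂ) = ((2⁻¹ : ℝ) : ℂ) := by push_cast; rfl
      rw [h2, Complex.im_mul_ofReal, Complex.log_im]
      ring
    rw [him]
    constructor <;> linarith [Complex.neg_pi_lt_arg z, Complex.arg_le_pi z]
  have h1 : ζ.re ^ 2 - ζ.im ^ 2 = z.re := by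
    rw [← hsq, sq ζ, Complex.mul_re]; ring
  have h2 : ζ.re ^ 2 + ζ.im ^ 2 = √(z.re ^ 2 + z.im ^ 2) := by
    have h3 : ‖ζ‖ ^ 2 = ‖z‖ := by rw [← norm_pow, hsq]
    rw [Complex.sq_norm, Complex.normSq_apply] at h3
    rw [Complex.norm_eq_sqrt_sq_add_sq] at h3
    rw [← h3]
    ring
  unfold reSqrt
  rw [← h2, ← h1, eq_comm, Real.sqrt_eq_iff_mul_self_eq (by nlinarith) hre]
  ring

theorem hasLaplacianAt_reSqrt {p : ℝ × ℝ} (hp : p.2 ≠ 0) : HasLaplacianAt reSqrt 0 p := by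
  have hfun : reSqrt = fun q : ℝ × ℝ => (((q.1 + q.2 * Complex.I : ℂ)) ^ (2⁻¹ : ℂ)).re := by
    funext q
    simp [re_cpow_half]
  have hz : (p.1 + p.2 * Complex.I : ℂ) ∈ Complex.slitPlane := by
    rw [Complex.mem_slitPlane_iff]
    right
    simpa using hp
  rw [hfun]
  refine HasLaplacianAt.re_comp (F := fun z => z ^ (2⁻¹ : ℂ))
    (F' := fun z => 2⁻¹ * z ^ (2⁻¹ - 1 : ℂ) * 1) ?_
    (((hasDerivAt_id _).cpow_const hz).const_mul (2⁻¹ : ℂ) |>.mul_const 1)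
  filter_upwards [Complex.isOpen_slitPlane.mem_nhds hz] with z hz
  exact (hasDerivAt_id z).cpow_const hz

theorem differentiableAt_sqrt_sq_add_sq {x : ℝ} (hx : 0 < x) :
    DifferentiableAt ℝ (fun s : ℝ => √(x ^ 2 + s ^ 2)) 0 :=
  DifferentiableAt.sqrt (by fun_prop) (by positivity)

theorem differentiableAt_reSqrt {x : ℝ} (hx : 0 < x) :
    DifferentiableAt ℝ (fun s => reSqrt (x, s)) 0 := by
  unfold reSqrt
  refine DifferentiableAt.sqrt ?_ (by positivity)
  exact ((differentiableAt_sqrt_sq_add_sq hx).add_const _).div_const _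

theorem hasNormalDeriv_reSqrt {x : ℝ} (hx : 0 < x) : HasNormalDeriv reSqrt 0 x :=
  HasNormalDeriv.of_even (differentiableAt_reSqrt hx) (fun s => by simp [reSqrt])

theorem half_disc_subset {x₀ ρ : ℝ} (hx₀ : |x₀| ≤ 1) (hρ : 0 < ρ) (hρ' : ρ ≤ 1 / 2) {p : ℝ × ℝ}
    (hp : (p.1 - x₀) ^ 2 + p.2 ^ 2 ≤ ρ ^ 2) :
    p.1 ^ 2 + p.2 ^ 2 < 4 ∧ |p.1| ≤ 3 / 2 ∧ |p.1 - x₀| ≤ ρ ∧ |p.2| ≤ ρ := by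
  have h1 : |p.1 - x₀| ≤ ρ := abs_le_of_sq_le_sq (by nlinarith) hρ.le
  have h2 : |p.2| ≤ ρ := abs_le_of_sq_le_sq (by nlinarith) hρ.le
  have h3 : |p.1| ≤ 3 / 2 := by
    have := abs_add_le (p.1 - x₀) x₀
    rw [sub_add_cancel] at this
    linarith
  refine ⟨?_, h3, h1, h2⟩
  have h4 := sq_le_sq' (by linarith [abs_nonneg p.1]) h3
  have h5 := sq_le_sq' (by linarith [abs_nonneg p.2]) (h2.trans hρ')
  rw [sq_abs] at h4 h5
  linarith

theorem half_disc_bound {x₀ ρ : ℝ} (hx₀ : |x₀| ≤ 1) (hρ : 0 < ρ) (hρ' : ρ ≤ 1 / 2) (p : ℝ × ℝ)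
    (hp : (p.1 - x₀) ^ 2 + p.2 ^ 2 - ρ ^ 2 ≤ 0) (_ : 0 ≤ p.2) : |p.1| ≤ 2 ∧ |p.2| ≤ 2 := by
  have := half_disc_subset hx₀ hρ hρ' (p := p) (by linarith)
  exact ⟨by linarith [this.2.1], by linarith [this.2.2.2]⟩

theorem hasLaplacianAt_harmonic_quadratic (x₀ A : ℝ) (p : ℝ × ℝ) :
    HasLaplacianAt (fun q => A * (q.2 ^ 2 - (q.1 - x₀) ^ 2)) 0 p :=
  ⟨_, _, HasSecondDerivAt.of_cubic (A * (p.2 ^ 2 - x₀ ^ 2)) (A * (2 * x₀)) (-A) 0 (fun s => by ring),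
    HasSecondDerivAt.of_cubic (-A * (p.1 - x₀) ^ 2) 0 A 0 (fun s => by ring), by ring⟩

theorem hasNormalDeriv_harmonic_quadratic (x₀ A x : ℝ) :
    HasNormalDeriv (fun q => A * (q.2 ^ 2 - (q.1 - x₀) ^ 2)) 0 x :=
  HasNormalDeriv.of_cubic (-A * (x - x₀) ^ 2) 0 A 0 (fun s => by ring)

/-- If two members of the family have the same normal derivative on one side of `x₀`, their
difference grows at least like a square root away from `x₀`. -/
theorem IsThinFamily.sqrt_lower_bound {θ κ η : ℝ} {φ : ℝ → ℝ} {u : ℝ → ℝ × ℝ → ℝ}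
    (h : IsThinFamily θ κ η φ u) {t t' : ℝ} (ht : t ∈ Icc (-1 : ℝ) 1)
    (ht' : t' ∈ Icc (-1 : ℝ) 1) (htt : t ≤ t') {x₀ σ ρ : ℝ} (hx₀ : |x₀| ≤ 1) (hσ : σ ^ 2 = 1)
    (hρ : 0 < ρ) (hρ' : ρ ≤ 1 / 2)
    (hN : ∀ x, 0 < σ * (x - x₀) → |x - x₀| < ρ →
      ∃ L, HasNormalDeriv (u t) L x ∧ HasNormalDeriv (u t') L x) {p : ℝ × ℝ}
    (hp : (p.1 - x₀) ^ 2 + p.2 ^ 2 ≤ ρ ^ 2) (hp2 : 0 ≤ p.2) :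
    η * √ρ / 144 * (t' - t) * (reSqrt (σ * p.1 + -(σ * x₀), p.2) +
      2 * √ρ / ρ ^ 2 * (p.2 ^ 2 - (p.1 - x₀) ^ 2)) ≤ u t' p - u t p := by
  set m := η * √ρ / 144 * (t' - t) with hm
  set A := 2 * √ρ / ρ ^ 2 with hA
  have hsρ : 0 < √ρ := Real.sqrt_pos.2 hρ
  have hm0 : 0 ≤ m := mul_nonneg (by have := h.η_pos; positivity) (by linarith)
  have hA0 : 0 < A := by positivity
  have hAρ : A * ρ ^ 2 = 2 * √ρ := by rw [hA]; field_simp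
  have hsub : ∀ {q : ℝ × ℝ}, (q.1 - x₀) ^ 2 + q.2 ^ 2 - ρ ^ 2 ≤ 0 → q.1 ^ 2 + q.2 ^ 2 < 4 ∧
      |q.1| ≤ 3 / 2 ∧ |q.1 - x₀| ≤ ρ ∧ |q.2| ≤ ρ := fun {q} hq =>
    half_disc_subset hx₀ hρ hρ' (p := q) (by linarith)
  have hXsq : ∀ x : ℝ, (σ * x + -(σ * x₀)) ^ 2 = (x - x₀) ^ 2 := fun x => by
    have : (σ * x + -(σ * x₀)) ^ 2 = σ ^ 2 * (x - x₀) ^ 2 := by ring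
    rw [this, hσ, one_mul]
  have hcont : ∀ τ ∈ Icc (-1 : ℝ) 1,
      ContinuousOn (u τ) {p | (p.1 - x₀) ^ 2 + p.2 ^ 2 - ρ ^ 2 ≤ 0 ∧ 0 ≤ p.2} := fun τ hτ =>
    (h.sol τ hτ).continuousOn.mono fun q hq => ⟨(hsub hq.1).1.le, hq.2⟩
  have key := nonneg_of_superharmonic_region
    (A := fun p : ℝ × ℝ => (p.1 - x₀) ^ 2 + p.2 ^ 2 - ρ ^ 2)
    (g := fun p => (u t' p - u t p) - m * (reSqrt (σ * p.1 + -(σ * x₀), p.2) +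
      A * (p.2 ^ 2 - (p.1 - x₀) ^ 2))) (by fun_prop) 2 (half_disc_bound hx₀ hρ hρ')
    ?_ ?_ ?_ ?_ p (by simpa using hp) hp2
  · linarith
  · refine ((hcont t' ht').sub (hcont t ht)).sub (Continuous.continuousOn ?_)
    have := continuous_reSqrt
    fun_prop
  · intro q hq hq2
    obtain ⟨h1, h2, h3, h4⟩ := hsub hq.le
    have hqe : (q.1 - x₀) ^ 2 + q.2 ^ 2 = ρ ^ 2 := by linarith
    have hs : reSqrt (σ * q.1 + -(σ * x₀), q.2) ≤ √ρ :=
      reSqrt_le hρ.le (by simp only [hXsq]; exact hqe.le)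
    show 0 ≤ (u t' q - u t q) - m * (reSqrt (σ * q.1 + -(σ * x₀), q.2) +
      A * (q.2 ^ 2 - (q.1 - x₀) ^ 2))
    rcases le_total q.2 (ρ / 2) with hy | hy
    · have h5 : A * (q.2 ^ 2 - (q.1 - x₀) ^ 2) ≤ A * (-(ρ ^ 2) / 2) :=
        mul_le_mul_of_nonneg_left (by nlinarith) hA0.le
      have h6 := mul_le_mul_of_nonneg_left (show reSqrt (σ * q.1 + -(σ * x₀), q.2) +
        A * (q.2 ^ 2 - (q.1 - x₀) ^ 2) ≤ 0 by linarith) hm0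
      linarith [h.le_of_le ht ht' htt h1.le hq2]
    · have h5 : A * (q.2 ^ 2 - (q.1 - x₀) ^ 2) ≤ A * ρ ^ 2 :=
        mul_le_mul_of_nonneg_left (by nlinarith) hA0.le
      have h6 := mul_le_mul_of_nonneg_left (show reSqrt (σ * q.1 + -(σ * x₀), q.2) +
        A * (q.2 ^ 2 - (q.1 - x₀) ^ 2) ≤ 3 * √ρ by linarith) hm0
      have h7 : m * (3 * √ρ) = η / 24 * (t' - t) * (ρ / 2) := by
        rw [hm]
        linear_combination (η / 48 * (t' - t)) * Real.mul_self_sqrt hρ.le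
      have h8 : η / 24 * (t' - t) * (ρ / 2) ≤ η / 24 * (t' - t) * q.2 :=
        mul_le_mul_of_nonneg_left hy (mul_nonneg (by linarith [h.η_pos]) (by linarith))
      linarith [h.lower_bound ht ht' htt h1.le hq2 h2]
  · intro q hq hq2
    have h1 := (hsub hq.le).1
    refine ⟨_, le_of_eq ?_, (((h.sol t' ht').laplacian q h1 hq2).sub
      ((h.sol t ht).laplacian q h1 hq2)).sub (HasLaplacianAt.const_mul m
      ((HasLaplacianAt.comp_affine_fst (x := q.1) (y := q.2) hσ
        (hasLaplacianAt_reSqrt (p := (σ * q.1 + -(σ * x₀), q.2)) hq2.ne')).add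
        (hasLaplacianAt_harmonic_quadratic x₀ A q)))⟩
    ring
  · intro x hx hneg
    have h1 := hsub hx.le
    rcases lt_or_ge 0 (σ * (x - x₀)) with h0 | h0
    · have hlt : |x - x₀| < ρ := abs_lt_of_sq_lt_sq (by simp at hx; linarith) hρ.le
      obtain ⟨L, hL, hL'⟩ := hN x h0 hlt
      refine ⟨_, le_of_eq ?_, (hL'.sub hL).sub (HasNormalDeriv.const_mul m
        ((HasNormalDeriv.comp_affine_fst (hasNormalDeriv_reSqrt (x := σ * x + -(σ * x₀))
          (by linarith))).add (hasNormalDeriv_harmonic_quadratic x₀ A x)))⟩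
      ring
    · exfalso
      have h2 : reSqrt (σ * x + -(σ * x₀), 0) = 0 := reSqrt_of_nonpos (by linarith)
      have h3 : u t (x, 0) ≤ u t' (x, 0) := h.le_of_le ht ht' htt (h1.1.le) le_rfl
      simp only [h2] at hneg
      have h4 : 0 ≤ m * (A * (x - x₀) ^ 2) := by positivity
      nlinarith

theorem reSqrt_zero_fst_sq {y : ℝ} (hy : 0 ≤ y) : reSqrt (0, y) ^ 2 = y / 2 := by
  rw [reSqrt_sq]
  simp [Real.sqrt_sq hy]

theorem not_le_normalDeriv_of_sqrt {w : ℝ × ℝ → ℝ} {x L m B ρ : ℝ} (hw : HasNormalDeriv w L x)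
    (hm : 0 < m) (hB : 0 ≤ B) (hρ : 0 < ρ) (h0 : w (x, 0) ≤ 0)
    (h : ∀ y, 0 ≤ y → y ≤ ρ → m * (reSqrt (0, y) + B * y ^ 2) ≤ w (x, y)) : False := by
  have h1 : ∀ᶠ s in 𝓝[>] (0 : ℝ), (w (x, s) - w (x, 0)) / s < |L| + 1 :=
    Tendsto.eventually_lt_const (by linarith [le_abs_self L]) hw
  have hpos : 0 < m ^ 2 / (2 * (|L| + 1) ^ 2) := by positivity
  obtain ⟨s, hs1, hs3⟩ := (h1.and (Ioo_mem_nhdsGT (lt_min hρ hpos))).exists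
  have hs0 : 0 < s := hs3.1
  have hs4 := lt_min_iff.1 hs3.2
  rw [div_lt_iff₀ hs0] at hs1
  have h2 := h s hs0.le hs4.1.le
  have h3 : m * reSqrt (0, s) ≤ (|L| + 1) * s := by nlinarith [mul_nonneg hB (sq_nonneg s)]
  have h4 : (m * reSqrt (0, s)) ^ 2 ≤ ((|L| + 1) * s) ^ 2 :=
    pow_le_pow_left₀ (mul_nonneg hm.le (reSqrt_nonneg _)) h3 2
  rw [mul_pow, reSqrt_zero_fst_sq hs0.le] at h4
  have h5 := hs4.2
  rw [lt_div_iff₀ (by positivity)] at h5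
  nlinarith

/-- The traces of the members of the family at the endpoints `±1` are strictly increasing. -/
theorem IsThinFamily.endpoint_lt {θ κ η : ℝ} {φ : ℝ → ℝ} {u : ℝ → ℝ × ℝ → ℝ}
    (h : IsThinFamily θ κ η φ u) {t t' : ℝ} (ht : t ∈ Icc (-1 : ℝ) 1)
    (ht' : t' ∈ Icc (-1 : ℝ) 1) (htt : t < t') {σ : ℝ} (hσ : σ ^ 2 = 1) :
    u t (σ, 0) < u t' (σ, 0) := by
  by_contra! hle
  have hσ1 : |σ| = 1 := by
    rw [← abs_one, ← sq_eq_sq_iff_abs_eq_abs, hσ, one_pow]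
  have key := fun (p : ℝ × ℝ) => h.sqrt_lower_bound ht ht' htt.le hσ1.le hσ
    (ρ := 1 / 2) (by norm_num) le_rfl (p := p) (fun x hx hx' => by
      have h1 : 1 < |x| := by
        have h2 : 1 < σ * x := by nlinarith
        calc 1 < σ * x := h2
          _ ≤ |σ * x| := le_abs_self _
          _ = |x| := by rw [abs_mul, hσ1, one_mul]
      have hx4 := (half_disc_subset (x₀ := σ) (ρ := 1 / 2) hσ1.le (by norm_num) le_rfl (p := (x, 0))
        (by have := sq_lt_sq' (by linarith [abs_nonneg (x - σ)]) hx'; rw [sq_abs] at this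
            simp only; linarith)).1
      obtain ⟨L, hL, hLκ, -⟩ := (h.sol t ht).normalDeriv x (by simpa using hx4)
      obtain ⟨L', hL', hLκ', -⟩ := (h.sol t' ht').normalDeriv x (by simpa using hx4)
      exact ⟨κ, hLκ h1 ▸ hL, hLκ' h1 ▸ hL'⟩)
  obtain ⟨L, hL, -⟩ := (h.sol t ht).normalDeriv σ (by rw [hσ]; norm_num)
  obtain ⟨L', hL', -⟩ := (h.sol t' ht').normalDeriv σ (by rw [hσ]; norm_num)
  refine not_le_normalDeriv_of_sqrt (hL'.sub hL) (m := η * √(1 / 2) / 144 * (t' - t))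
    (B := 2 * √(1 / 2) / (1 / 2) ^ 2) (ρ := 1 / 2) ?_ (by positivity) (by norm_num)
    (by linarith) fun y hy hy' => ?_
  · exact mul_pos (by have := h.η_pos; positivity) (by linarith)
  · have := key (σ, y) (by simp only; nlinarith) hy
    simpa using this

theorem reSqrt_mul_reSqrt_neg {x y : ℝ} (hy : 0 ≤ y) : reSqrt (x, y) * reSqrt (-x, y) = y / 2 := by
  refine (pow_left_inj₀ (mul_nonneg (reSqrt_nonneg _) (reSqrt_nonneg _)) (by positivity)
    two_ne_zero).1 ?_
  rw [mul_pow, reSqrt_sq, reSqrt_sq]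
  have h := Real.sq_sqrt (show 0 ≤ x ^ 2 + y ^ 2 by positivity)
  simp only [neg_sq]
  linear_combination h / 4

theorem reSqrt_of_nonneg {x : ℝ} (hx : 0 ≤ x) : reSqrt (x, 0) = √x := by
  simp [reSqrt, Real.sqrt_sq hx]

theorem hasNormalDeriv_reSqrt_neg {x : ℝ} (hx : 0 < x) :
    HasNormalDeriv (fun q => reSqrt (-1 * q.1 + 0, q.2)) (1 / (2 * √x)) x := by
  have hc : Tendsto (fun s : ℝ => 1 / (2 * reSqrt (x, s))) (𝓝[>] 0) (𝓝 (1 / (2 * √x))) := by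
    rw [← reSqrt_of_nonneg hx.le]
    have hne : 2 * reSqrt (x, 0) ≠ 0 := by
      rw [reSqrt_of_nonneg hx.le]; positivity
    have h1 : ContinuousAt (fun s : ℝ => 1 / (2 * reSqrt (x, s))) 0 := by
      have := continuous_reSqrt
      exact ContinuousAt.div (by fun_prop) (by fun_prop) hne
    exact h1.tendsto.mono_left nhdsWithin_le_nhds
  refine hc.congr' ?_
  filter_upwards [self_mem_nhdsWithin] with s hs
  have hs : 0 < s := hs
  have h0 : reSqrt (-x, 0) = 0 := reSqrt_of_nonpos (by linarith)
  have h1 := reSqrt_mul_reSqrt_neg (x := x) hs.le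
  have h2 : 0 < reSqrt (x, s) := lt_of_le_of_ne (reSqrt_nonneg _) fun h => by
    rw [← h] at h1; linarith
  simp only [neg_mul, one_mul, add_zero, h0, sub_zero]
  field_simp
  linarith

theorem reSqrt_sub_reSqrt_neg {x y : ℝ} (hx : 0 ≤ x) (hy : 0 ≤ y) :
    0 ≤ reSqrt (x, y) - reSqrt (-x, y) ∧
      (reSqrt (x, y) - reSqrt (-x, y)) * √(x + y) ≤ x := by
  have ha := reSqrt_sq (x, y)
  have hb := reSqrt_sq (-x, y)
  have hab := reSqrt_mul_reSqrt_neg (x := x) hy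
  have ha0 := reSqrt_nonneg (x, y)
  have hb0 := reSqrt_nonneg (-x, y)
  simp only [neg_sq] at ha hb
  have hr := abs_fst_le_sqrt (x, y)
  rw [abs_of_nonneg hx] at hr
  simp only at hr
  set a := reSqrt (x, y)
  set b := reSqrt (-x, y)
  have h0 : 0 ≤ a - b := by
    have : b ≤ a := (pow_le_pow_iff_left₀ hb0 ha0 two_ne_zero).1 (by linarith)
    linarith
  have h1 : √(x + y) ≤ a + b := Real.sqrt_le_iff.2 ⟨by positivity, by nlinarith⟩
  refine ⟨h0, (mul_le_mul_of_nonneg_left h1 h0).trans ?_⟩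
  nlinarith

theorem IsThinSolution.sub_reflection_le {θ κ : ℝ} {φ : ℝ → ℝ} {u : ℝ × ℝ → ℝ}
    (h : IsThinSolution θ κ φ u) (hθ : 0 ≤ θ) {M : ℝ}
    (hM : ∀ p : ℝ × ℝ, p.1 ^ 2 + p.2 ^ 2 ≤ 4 → 0 ≤ p.2 → |u p| ≤ M) {x₀ y₀ σ ρ X : ℝ}
    (hσ : σ ^ 2 = 1) (hρ : 0 < ρ) (hρ' : ρ ≤ 1 / 4) (hx₀ : |x₀| + ρ ≤ 1) (hy₀ : 0 ≤ y₀)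
    (hy₀' : y₀ ≤ 1 / 4) (hX : 0 ≤ X) (hX' : X ≤ ρ) :
    (u (σ * X + x₀, y₀) - u (-σ * X + x₀, y₀)) * √(X + y₀) ≤ (4 * θ + 4 * M / ρ) * X := by
  have hM0 : 0 ≤ M := (abs_nonneg _).trans (hM (0, 0) (by norm_num) le_rfl)
  have hσ' : |σ| = 1 := by rw [← abs_one, ← sq_eq_sq_iff_abs_eq_abs, hσ, one_pow]
  have hsub : ∀ {q : ℝ × ℝ}, max (q.1 ^ 2 + (q.2 - y₀) ^ 2 - ρ ^ 2) (-q.1) ≤ 0 →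
      0 ≤ q.1 ∧ q.1 ≤ ρ ∧ q.1 ^ 2 + (q.2 - y₀) ^ 2 ≤ ρ ^ 2 ∧ |q.2 - y₀| ≤ ρ := fun {q} hq => by
    obtain ⟨h1, h2⟩ := max_le_iff.1 hq
    exact ⟨by linarith, abs_le_of_sq_le_sq' (by nlinarith [sq_nonneg (q.2 - y₀)]) hρ.le |>.2,
      by linarith, abs_le_of_sq_le_sq (by nlinarith [sq_nonneg q.1]) hρ.le⟩
  have hline : ∀ {τ x : ℝ}, |τ| = 1 → 0 ≤ x → x ≤ ρ → |τ * x + x₀| ≤ 1 := fun {τ x} h1 h2 h3 => by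
    have := abs_add_le (τ * x) x₀
    rw [abs_mul, h1, abs_of_nonneg h2] at this
    linarith
  have hdom : ∀ {τ : ℝ}, |τ| = 1 → ∀ {q : ℝ × ℝ},
      max (q.1 ^ 2 + (q.2 - y₀) ^ 2 - ρ ^ 2) (-q.1) ≤ 0 →
      0 ≤ q.2 → (τ * q.1 + x₀) ^ 2 + q.2 ^ 2 < 4 := fun {τ} h1 {q} hq hq2 => by
    obtain ⟨h2, h3, -, h4⟩ := hsub hq
    have h5 := abs_le.1 (hline h1 h2 h3)
    have h6 := abs_le.1 h4
    nlinarith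
  have hσn : |(-σ)| = 1 := by rwa [abs_neg]
  have hcont : ∀ {τ : ℝ}, |τ| = 1 → ContinuousOn (fun q : ℝ × ℝ => u (τ * q.1 + x₀, q.2))
      {q | max (q.1 ^ 2 + (q.2 - y₀) ^ 2 - ρ ^ 2) (-q.1) ≤ 0 ∧ 0 ≤ q.2} := fun {τ} h1 =>
    h.continuousOn.comp (f := fun q : ℝ × ℝ => (τ * q.1 + x₀, q.2))
      (Continuous.continuousOn (by fun_prop)) fun q hq => ⟨(hdom h1 hq.1 hq.2).le, hq.2⟩
  have hcs := continuous_reSqrt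
  have hBρ : 2 * M / ρ ^ 2 * ρ ^ 2 = 2 * M := by field_simp
  have key := nonneg_of_superharmonic_region
    (A := fun q : ℝ × ℝ => max (q.1 ^ 2 + (q.2 - y₀) ^ 2 - ρ ^ 2) (-q.1))
    (g := fun q => 4 * θ * (reSqrt q - reSqrt (-1 * q.1 + 0, q.2)) +
      (4 * M / ρ * q.1 + 2 * M / ρ ^ 2 * ((q.2 - y₀) ^ 2 - q.1 ^ 2)) -
      (u (σ * q.1 + x₀, q.2) - u (-σ * q.1 + x₀, q.2))) (by fun_prop) 1
    (fun q hq hq2 => ?_) ?_ ?_ ?_ ?_ (X, y₀) (max_le (by simp only; nlinarith) (by simpa using hX))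
    hy₀
  · simp only [sub_self] at key
    obtain ⟨h1, h2⟩ := reSqrt_sub_reSqrt_neg hX hy₀
    have h3 : √(X + y₀) ≤ 1 := Real.sqrt_le_iff.2 ⟨by norm_num, by linarith⟩
    have h4 := Real.sqrt_nonneg (X + y₀)
    have h5 : u (σ * X + x₀, y₀) - u (-σ * X + x₀, y₀) ≤
        4 * θ * (reSqrt (X, y₀) - reSqrt (-X, y₀)) + 4 * M / ρ * X := by
      have h6 : 0 ≤ 2 * M / ρ ^ 2 * X ^ 2 := by positivity
      simp only [neg_mul, one_mul, add_zero] at key ⊢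
      linarith
    have h7 : 4 * M / ρ * X * √(X + y₀) ≤ 4 * M / ρ * X * 1 :=
      mul_le_mul_of_nonneg_left h3 (by positivity)
    have h8 := mul_le_mul_of_nonneg_left h2 (show 0 ≤ 4 * θ by positivity)
    have h9 := mul_le_mul_of_nonneg_right h5 h4
    linarith
  · obtain ⟨h1, h2, -, h3⟩ := hsub hq
    have := abs_le.1 h3
    exact ⟨abs_le.2 ⟨by linarith, by linarith⟩, abs_le.2 ⟨by linarith, by linarith⟩⟩
  · exact ContinuousOn.sub (Continuous.continuousOn (by fun_prop)) ((hcont hσ').sub (hcont hσn))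
  · intro q hq hq2
    obtain ⟨h1, h2, -, h3⟩ := hsub hq.le
    have h4 := (reSqrt_sub_reSqrt_neg h1 hq2).1
    have h5 := abs_le.1 (hM (σ * q.1 + x₀, q.2) (hdom hσ' hq.le hq2).le hq2)
    have h6 := abs_le.1 (hM (-σ * q.1 + x₀, q.2) (hdom hσn hq.le hq2).le hq2)
    have h7 : 0 ≤ 4 * θ * (reSqrt (q.1, q.2) - reSqrt (-q.1, q.2)) := by positivity
    show 0 ≤ 4 * θ * (reSqrt (q.1, q.2) - reSqrt (-1 * q.1 + 0, q.2)) +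
      (4 * M / ρ * q.1 + 2 * M / ρ ^ 2 * ((q.2 - y₀) ^ 2 - q.1 ^ 2)) -
      (u (σ * q.1 + x₀, q.2) - u (-σ * q.1 + x₀, q.2))
    rw [neg_one_mul, add_zero]
    rcases max_choice (q.1 ^ 2 + (q.2 - y₀) ^ 2 - ρ ^ 2) (-q.1) with h8 | h8
    · rw [h8] at hq
      have h9 : (q.2 - y₀) ^ 2 = ρ ^ 2 - q.1 ^ 2 := by linarith
      have h10 : 4 * M / ρ * q.1 + 2 * M / ρ ^ 2 * ((q.2 - y₀) ^ 2 - q.1 ^ 2) =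
          2 * M + 4 * M / ρ ^ 2 * (q.1 * (ρ - q.1)) := by
        rw [h9]; field_simp; ring
      have h11 : 0 ≤ 4 * M / ρ ^ 2 * (q.1 * (ρ - q.1)) :=
        mul_nonneg (by positivity) (mul_nonneg h1 (by linarith))
      linarith
    · rw [h8] at hq
      have h9 : q.1 = 0 := by linarith
      have h10 : 0 ≤ 2 * M / ρ ^ 2 * (q.2 - y₀) ^ 2 := by positivity
      simp only [h9] at h7 ⊢
      simp only [mul_zero, neg_zero]
      linarith
  · intro q hq hq2
    have hl1 := h.laplacian (σ * q.1 + x₀, q.2) (hdom hσ' hq.le hq2.le) hq2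
    have hl2 := h.laplacian (-σ * q.1 + x₀, q.2) (hdom hσn hq.le hq2.le) hq2
    have hl3 : HasLaplacianAt (fun q : ℝ × ℝ =>
        4 * M / ρ * q.1 + 2 * M / ρ ^ 2 * ((q.2 - y₀) ^ 2 - q.1 ^ 2)) 0 q :=
      ⟨_, _, HasSecondDerivAt.of_cubic (2 * M / ρ ^ 2 * (q.2 - y₀) ^ 2) (4 * M / ρ)
          (-(2 * M / ρ ^ 2)) 0 (fun s => by ring),
        HasSecondDerivAt.of_cubic (4 * M / ρ * q.1 + 2 * M / ρ ^ 2 * (y₀ ^ 2 - q.1 ^ 2))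
          (2 * M / ρ ^ 2 * (-2 * y₀)) (2 * M / ρ ^ 2) 0 (fun s => by ring), by ring⟩
    refine ⟨_, le_of_eq ?_, (((HasLaplacianAt.const_mul (4 * θ)
      ((hasLaplacianAt_reSqrt hq2.ne').sub (HasLaplacianAt.comp_affine_fst (x := q.1) (y := q.2)
        (σ := -1) (c := 0) (by norm_num)
        (hasLaplacianAt_reSqrt (p := (-1 * q.1 + 0, q.2)) hq2.ne')))).add hl3).sub
      ((HasLaplacianAt.comp_affine_fst (x := q.1) (y := q.2) hσ hl1).sub
        (HasLaplacianAt.comp_affine_fst (x := q.1) (y := q.2) (by rwa [neg_sq]) hl2)))⟩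
    ring
  · intro x hx hneg
    obtain ⟨hA1, hA2⟩ := max_lt_iff.1 hx
    simp only at hA1 hA2
    have hx0 : 0 < x := by linarith
    obtain ⟨-, hxρ, -, -⟩ := hsub hx.le
    obtain ⟨L₁, hL₁, -, hb₁⟩ := h.normalDeriv (σ * x + x₀)
      (by simpa using hdom hσ' hx.le le_rfl)
    obtain ⟨L₂, hL₂, -, hb₂⟩ := h.normalDeriv (-σ * x + x₀)
      (by simpa using hdom hσn hx.le le_rfl)
    have hb₁ := abs_le.1 (hb₁ (hline hσ' hx0.le hxρ)).1
    have hb₂ := abs_le.1 (hb₂ (hline hσn hx0.le hxρ)).1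
    have hn : HasNormalDeriv (fun q : ℝ × ℝ =>
        4 * M / ρ * q.1 + 2 * M / ρ ^ 2 * ((q.2 - y₀) ^ 2 - q.1 ^ 2))
        (2 * M / ρ ^ 2 * (-2 * y₀)) x :=
      HasNormalDeriv.of_cubic (4 * M / ρ * x + 2 * M / ρ ^ 2 * (y₀ ^ 2 - x ^ 2))
        _ (2 * M / ρ ^ 2) 0 (fun s => by ring)
    refine ⟨_, ?_, ((HasNormalDeriv.const_mul (4 * θ) ((hasNormalDeriv_reSqrt hx0).sub
      (hasNormalDeriv_reSqrt_neg hx0))).add hn).sub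
      ((HasNormalDeriv.comp_affine_fst hL₁).sub (HasNormalDeriv.comp_affine_fst hL₂))⟩
    have hs1 : √x ≤ 1 := Real.sqrt_le_iff.2 ⟨by norm_num, by linarith⟩
    have hs0 : 0 < √x := Real.sqrt_pos.2 hx0
    have h1 : 1 / 2 ≤ 1 / (2 * √x) := one_div_le_one_div_of_le (by positivity) (by linarith)
    have h2 := mul_le_mul_of_nonneg_left h1 (show 0 ≤ 4 * θ by positivity)
    have h3 : 0 ≤ 2 * M / ρ ^ 2 * y₀ := by positivity
    linarith

theorem IsThinSolution.abs_sub_le {θ κ : ℝ} {φ : ℝ → ℝ} {u : ℝ × ℝ → ℝ}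
    (h : IsThinSolution θ κ φ u) (hθ : 0 ≤ θ) {M : ℝ}
    (hM : ∀ p : ℝ × ℝ, p.1 ^ 2 + p.2 ^ 2 ≤ 4 → 0 ≤ p.2 → |u p| ≤ M) {x y k ρ : ℝ}
    (hρ : 0 < ρ) (hρ' : ρ ≤ 1 / 4) (hx : |x| + 2 * ρ ≤ 1) (hy : 0 ≤ y)
    (hy' : y ≤ 1 / 4) (hk : |k| ≤ ρ) :
    |u (x + k, y) - u (x, y)| * √(|k| + y) ≤ (4 * θ + 4 * M / ρ) * |k| := by
  have hM0 : 0 ≤ M := (abs_nonneg _).trans (hM (0, 0) (by norm_num) le_rfl)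
  have hx₀ : |x + k / 2| + ρ ≤ 1 := by
    have := abs_add_le x (k / 2)
    rw [abs_div, abs_two] at this
    linarith
  have key : ∀ σ : ℝ, σ ^ 2 = 1 → (u (σ * (|k| / 2) + (x + k / 2), y) -
      u (-σ * (|k| / 2) + (x + k / 2), y)) * √(|k| / 2 + y) ≤
      (4 * θ + 4 * M / ρ) * (|k| / 2) := fun σ hσ =>
    h.sub_reflection_le hθ hM hσ hρ hρ' hx₀ hy hy' (by positivity) (by linarith [abs_nonneg k])
  have h1 : |u (x + k, y) - u (x, y)| * √(|k| / 2 + y) ≤ (4 * θ + 4 * M / ρ) * (|k| / 2) := by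
    have e1 := key 1 (by norm_num)
    have e2 := key (-1) (by norm_num)
    rcases abs_cases k with ⟨hk1, -⟩ | ⟨hk1, -⟩ <;> rw [hk1] at e1 e2 ⊢ <;>
      rcases abs_cases (u (x + k, y) - u (x, y)) with ⟨hu, -⟩ | ⟨hu, -⟩ <;> rw [hu]
    · refine le_trans (le_of_eq ?_) e1; ring_nf
    · refine le_trans (le_of_eq ?_) e2; ring_nf
    · refine le_trans (le_of_eq ?_) e2; ring_nf
    · refine le_trans (le_of_eq ?_) e1; ring_nf
  have h2 : √(|k| + y) ≤ 2 * √(|k| / 2 + y) := by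
    refine Real.sqrt_le_iff.2 ⟨by positivity, ?_⟩
    rw [mul_pow, Real.sq_sqrt (by positivity)]
    linarith [abs_nonneg k]
  have h3 := mul_le_mul_of_nonneg_left h2 (abs_nonneg (u (x + k, y) - u (x, y)))
  linarith

theorem hasDerivAt_integral_comp_affine {k a b g g' : ℝ → ℝ} (hk : Continuous k)
    (ha : Continuous a) (hb : Continuous b) (hg' : Continuous g') (hg : ∀ x, HasDerivAt g (g' x) x)
    (τ : ℝ) :
    HasDerivAt (fun τ => ∫ s in (-1 : ℝ)..1, k s * g (a s + b s * τ))
      (∫ s in (-1 : ℝ)..1, k s * (b s * g' (a s + b s * τ))) τ := by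
  have hgc : Continuous g := continuous_iff_continuousAt.2 fun x => (hg x).continuousAt
  have hF : Continuous (fun q : ℝ × ℝ => k q.2 * (b q.2 * g' (a q.2 + b q.2 * q.1))) := by fun_prop
  obtain ⟨C, hC⟩ := ((isCompact_closedBall τ 1).prod (isCompact_Icc (a := (-1 : ℝ)) (b := 1))
    ).exists_bound_of_continuousOn hF.continuousOn
  refine (intervalIntegral.hasDerivAt_integral_of_dominated_loc_of_deriv_le
    (F := fun τ s => k s * g (a s + b s * τ)) (F' := fun τ s => k s * (b s * g' (a s + b s * τ)))
    (bound := fun _ => C) (Metric.closedBall_mem_nhds τ one_pos) ?_ ?_ ?_ ?_ ?_ ?_).2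
  · exact Eventually.of_forall fun τ => Continuous.aestronglyMeasurable (by fun_prop)
  · exact Continuous.intervalIntegrable (by fun_prop) _ _
  · exact Continuous.aestronglyMeasurable (by fun_prop)
  · refine Eventually.of_forall fun s hs t ht => hC (t, s) ⟨ht, ?_⟩
    rw [uIoc_of_le (by norm_num)] at hs
    exact ⟨hs.1.le, hs.2⟩
  · exact intervalIntegrable_const
  · refine Eventually.of_forall fun s _ t _ => ?_
    have h1 : HasDerivAt (fun t => a s + b s * t) (b s) t := by
      simpa using ((hasDerivAt_id t).const_mul (b s)).const_add (a s)
    refine (((hg _).comp t h1).const_mul (k s)).congr_deriv (by ring)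

/-- The average `(2 / π) ∫₋₁¹ D (x + y s) / (1 + s²) ds`, an extension of `D` to the plane. -/
noncomputable def lineAverage (D : ℝ → ℝ) (p : ℝ × ℝ) : ℝ :=
  2 / Real.pi * ∫ s in (-1 : ℝ)..1, (1 + s ^ 2)⁻¹ * D (p.1 + s * p.2)

section lineAverage

theorem continuous_inv_one_add_sq : Continuous fun s : ℝ => (1 + s ^ 2)⁻¹ :=
  Continuous.inv₀ (by fun_prop) fun s => by positivity

variable {D D' D'' : ℝ → ℝ}

theorem continuous_lineAverage (hD : Continuous D) : Continuous (lineAverage D) := by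
  unfold lineAverage
  refine continuous_const.mul (intervalIntegral.continuous_parametric_intervalIntegral_of_continuous'
    (f := fun (p : ℝ × ℝ) s => (1 + s ^ 2)⁻¹ * D (p.1 + s * p.2)) ?_ _ _)
  exact (continuous_inv_one_add_sq.comp continuous_snd).mul (hD.comp (by fun_prop))

theorem lineAverage_zero_snd (x : ℝ) : lineAverage D (x, 0) = D x := by
  simp only [lineAverage, mul_zero, add_zero, intervalIntegral.integral_mul_const,
    integral_inv_one_add_sq, Real.arctan_neg, Real.arctan_one]
  field_simp
  norm_num

theorem abs_lineAverage_le {p : ℝ × ℝ} {S : ℝ}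
    (hS : ∀ s ∈ Icc (-1 : ℝ) 1, |D (p.1 + s * p.2)| ≤ S) : |lineAverage D p| ≤ 2 * S := by
  have h0 : 0 ≤ S := (abs_nonneg _).trans (hS 0 (by norm_num))
  have h1 := intervalIntegral.norm_integral_le_of_norm_le_const (a := -1) (b := 1) (C := S)
    (f := fun s : ℝ => (1 + s ^ 2)⁻¹ * D (p.1 + s * p.2)) fun s hs => by
      rw [uIoc_of_le (by norm_num)] at hs
      have h2 : (1 + s ^ 2)⁻¹ ≤ 1 := inv_le_one_of_one_le₀ (by nlinarith [sq_nonneg s])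
      have h3 : 0 ≤ (1 + s ^ 2)⁻¹ := by positivity
      rw [norm_mul, Real.norm_eq_abs, Real.norm_eq_abs, abs_of_nonneg h3]
      exact (mul_le_mul h2 (hS s ⟨hs.1.le, hs.2⟩) (abs_nonneg _) zero_le_one).trans (one_mul S).le
  rw [Real.norm_eq_abs] at h1
  norm_num at h1
  have hpi : 2 / Real.pi ≤ 1 := (div_le_one Real.pi_pos).2 Real.two_le_pi
  rw [lineAverage, abs_mul, abs_of_pos (div_pos two_pos Real.pi_pos)]
  have := mul_le_mul hpi h1 (abs_nonneg _) zero_le_one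
  linarith

theorem hasNormalDeriv_lineAverage (hD : ∀ x, HasDerivAt D (D' x) x) (hD' : Continuous D') (x : ℝ) :
    HasNormalDeriv (lineAverage D) 0 x := by
  refine HasNormalDeriv.of_even ?_ fun y => ?_
  · exact ((hasDerivAt_integral_comp_affine continuous_inv_one_add_sq (continuous_const (y := x))
      continuous_id hD' hD 0).const_mul (2 / Real.pi)).differentiableAt
  · have := intervalIntegral.integral_comp_neg (a := -1) (b := 1)
      (f := fun s : ℝ => (1 + s ^ 2)⁻¹ * D (x + s * y))
    rw [neg_neg] at this
    simp only [lineAverage]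
    rw [← this]
    simp

theorem hasLaplacianAt_lineAverage (hD : ∀ x, HasDerivAt D (D' x) x)
    (hD' : ∀ x, HasDerivAt D' (D'' x) x) (hD'' : Continuous D'') {p : ℝ × ℝ} (hp : p.2 ≠ 0) :
    HasLaplacianAt (lineAverage D) (2 / Real.pi * ((D' (p.1 + p.2) - D' (p.1 - p.2)) / p.2)) p := by
  obtain ⟨x, y⟩ := p
  simp only at hp ⊢
  have hD'c : Continuous D' := continuous_iff_continuousAt.2 fun x => (hD' x).continuousAt
  have hk := continuous_inv_one_add_sq
  have hx1 : ∀ τ, HasDerivAt (fun τ => lineAverage D (τ, y))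
      (2 / Real.pi * ∫ s in (-1 : ℝ)..1, (1 + s ^ 2)⁻¹ * D' (s * y + 1 * τ)) τ := fun τ => by
    have := (hasDerivAt_integral_comp_affine hk (a := fun s => s * y) (by fun_prop)
      (continuous_const (y := (1 : ℝ))) hD'c hD τ).const_mul (2 / Real.pi)
    simpa [lineAverage, add_comm] using this
  have hx2 := (hasDerivAt_integral_comp_affine hk (a := fun s => s * y) (by fun_prop)
      (continuous_const (y := (1 : ℝ))) hD'' hD' x).const_mul (2 / Real.pi)
  have hy1 : ∀ τ, HasDerivAt (fun τ => lineAverage D (x, τ))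
      (2 / Real.pi * ∫ s in (-1 : ℝ)..1, ((1 + s ^ 2)⁻¹ * s) * D' (x + s * τ)) τ := fun τ => by
    have := (hasDerivAt_integral_comp_affine hk (continuous_const (y := x)) continuous_id
      hD'c hD τ).const_mul (2 / Real.pi)
    simpa [lineAverage, mul_assoc] using this
  have hy2 := (hasDerivAt_integral_comp_affine (k := fun s => (1 + s ^ 2)⁻¹ * s) (by fun_prop)
    (continuous_const (y := x)) continuous_id hD'' hD' y).const_mul (2 / Real.pi)
  refine ⟨_, _, ⟨_, Eventually.of_forall hx1, hx2⟩, ⟨_, Eventually.of_forall hy1, hy2⟩, ?_⟩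
  rw [← mul_add, ← intervalIntegral.integral_add (Continuous.intervalIntegrable (by fun_prop) _ _)
    (Continuous.intervalIntegrable (by fun_prop) _ _)]
  have hderiv_avg : ∫ s in (-1 : ℝ)..1, D'' (x + y * s) = (D' (x + y) - D' (x - y)) / y := by
    have h1 : ∀ s : ℝ, HasDerivAt (fun s => D' (x + y * s) / y) (D'' (x + y * s)) s := fun s => by
      have h2 : HasDerivAt (fun s => x + y * s) y s := by
        simpa using ((hasDerivAt_id s).const_mul y).const_add x
      exact (((hD' _).comp s h2).div_const y).congr_deriv (by field_simp)
    rw [intervalIntegral.integral_eq_sub_of_hasDerivAt (fun s _ => h1 s)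
      (Continuous.intervalIntegrable (by fun_prop) _ _)]
    rw [mul_one, mul_neg, mul_one, ← sub_eq_add_neg]
    ring
  rw [← hderiv_avg]
  congr 2
  funext s
  have h1 : (1 + s ^ 2) ≠ 0 := by positivity
  simp only [id]
  rw [show s * y + 1 * x = x + y * s by ring, show x + s * y = x + y * s by ring]
  field_simp

end lineAverage

theorem hasSecondDerivAt_rpow (c α : ℝ) {y : ℝ} (hy : 0 < y) :
    HasSecondDerivAt (fun y => c * y ^ (1 + α)) (c * ((1 + α) * (α * y ^ (α - 1)))) y := by
  refine ⟨fun y => c * ((1 + α) * y ^ α), ?_, ?_⟩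
  · filter_upwards [lt_mem_nhds hy] with s hs
    refine ((Real.hasDerivAt_rpow_const (p := 1 + α) (Or.inl hs.ne')).const_mul c).congr_deriv ?_
    rw [add_sub_cancel_left]
  · exact ((Real.hasDerivAt_rpow_const (p := α) (Or.inl hy.ne')).const_mul (1 + α)).const_mul c

/-- `φ` is of class `C²`, with second derivative Hölder continuous on `[-1,1]`. -/
def IsC2Holder (φ : ℝ → ℝ) : Prop :=
  ∃ (φ' φ'' : ℝ → ℝ) (α M : ℝ), 0 < α ∧ (∀ x, HasDerivAt φ (φ' x) x) ∧
    (∀ x, HasDerivAt φ' (φ'' x) x) ∧ Continuous φ'' ∧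
    ∀ x ∈ Icc (-1 : ℝ) 1, ∀ y ∈ Icc (-1 : ℝ) 1, |φ'' x - φ'' y| ≤ M * |x - y| ^ α

theorem IsC2Holder.neg {φ : ℝ → ℝ} (h : IsC2Holder φ) : IsC2Holder (fun x => -φ x) := by
  obtain ⟨φ', φ'', α, M, hα, h1, h2, h3, h4⟩ := h
  refine ⟨fun x => -φ' x, fun x => -φ'' x, α, M, hα, fun x => (h1 x).neg, fun x => (h2 x).neg,
    h3.neg, fun x hx y hy => ?_⟩
  rw [neg_sub_neg, abs_sub_comm]
  exact h4 x hx y hy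

theorem IsC2Holder.continuous {φ : ℝ → ℝ} (h : IsC2Holder φ) : Continuous φ := by
  obtain ⟨φ', -, -, -, -, h1, -⟩ := h
  exact continuous_iff_continuousAt.2 fun x => (h1 x).continuousAt

/-- A subharmonic extension, with vanishing normal derivative and of size `O(|k|)`, of the
increments of a `C^{2,α}` function. -/
theorem IsC2Holder.exists_subharmonic_extension {φ : ℝ → ℝ} (h : IsC2Holder φ) :
    ∃ C > 0, ∀ k : ℝ, ∃ Q : ℝ × ℝ → ℝ, Continuous Q ∧ (∀ x, Q (x, 0) = φ x - φ (x + k)) ∧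
      (∀ x, HasNormalDeriv Q 0 x) ∧
      (∀ x y, 0 < y → |x| + y + |k| ≤ 1 → ∃ ℓ ≥ 0, HasLaplacianAt Q ℓ (x, y)) ∧
      (∀ x y, 0 ≤ y → |x| + y + |k| ≤ 1 → |Q (x, y)| ≤ C * |k|) := by
  obtain ⟨φ', φ'', α, M, hα, hφ, hφ', hφ'', hM⟩ := h
  have hφ'c : Continuous φ' := continuous_iff_continuousAt.2 fun x => (hφ' x).continuousAt
  have hφc : Continuous φ := continuous_iff_continuousAt.2 fun x => (hφ x).continuousAt
  have hM0 : 0 ≤ M := by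
    have := (abs_nonneg _).trans (hM 1 (by norm_num) 0 (by norm_num))
    simpa using this
  obtain ⟨S, hS⟩ := (isCompact_Icc (a := (-1 : ℝ)) (b := 1)).exists_bound_of_continuousOn
    hφ'c.continuousOn
  have hS0 : 0 ≤ S := (norm_nonneg _).trans (hS 0 (by norm_num))
  set c := M * 2 ^ α / ((1 + α) * α) with hc
  have hc0 : 0 ≤ c := by positivity
  refine ⟨2 * S + c + 1, by positivity, fun k => ?_⟩
  set D : ℝ → ℝ := fun x => φ x - φ (x + k)
  set D' : ℝ → ℝ := fun x => φ' x - φ' (x + k)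
  have hD : ∀ x, HasDerivAt D (D' x) x := fun x => (hφ x).sub ((hφ _).comp_add_const x k)
  have hD' : ∀ x, HasDerivAt D' (φ'' x - φ'' (x + k)) x := fun x =>
    (hφ' x).sub ((hφ' _).comp_add_const x k)
  have hD'c : Continuous D' := by fun_prop
  have hnd : ∀ x, HasNormalDeriv (fun q => c * |k| * q.2 ^ (1 + α)) 0 x := fun x => by
    refine HasNormalDeriv.of_hasDerivAt ?_
    refine ((Real.hasDerivAt_rpow_const (p := 1 + α) (Or.inr (by linarith))).const_mul
      (c * |k|)).congr_deriv ?_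
    rw [add_sub_cancel_left, Real.zero_rpow hα.ne']
    ring
  have hmem : ∀ {x y s : ℝ}, |s| ≤ 1 → 0 ≤ y → |x| + y + |k| ≤ 1 →
      x + s * y ∈ Icc (-1 : ℝ) 1 ∧ x + s * y + k ∈ Icc (-1 : ℝ) 1 := fun {x y s} hs hy hxy => by
    have h1 : |s * y| ≤ y := by
      rw [abs_mul, abs_of_nonneg hy]
      exact mul_le_of_le_one_left hy hs
    have h1 := abs_le.1 h1
    have h2 := abs_le.1 (le_refl |x|)
    have h3 := abs_le.1 (le_refl |k|)
    have h4 := abs_nonneg k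
    exact ⟨⟨by linarith, by linarith⟩, ⟨by linarith, by linarith⟩⟩
  refine ⟨fun q => lineAverage D q + c * |k| * q.2 ^ (1 + α), ?_, fun x => ?_, fun x => ?_, ?_, ?_⟩
  · refine (continuous_lineAverage (by fun_prop)).add (continuous_const.mul ?_)
    exact continuous_snd.rpow_const fun q => Or.inr (by linarith)
  · simp only [lineAverage_zero_snd, Real.zero_rpow (show 1 + α ≠ 0 by linarith), mul_zero, add_zero]
    rfl
  · simpa using (hasNormalDeriv_lineAverage hD hD'c x).add (hnd x)
  · intro x y hy hxy
    have hB : HasLaplacianAt (fun q => c * |k| * q.2 ^ (1 + α))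
        (0 + c * |k| * ((1 + α) * (α * y ^ (α - 1)))) (x, y) :=
      ⟨_, _, HasSecondDerivAt.of_cubic (c * |k| * y ^ (1 + α)) 0 0 0 (fun s => by simp),
        hasSecondDerivAt_rpow _ _ hy, by ring⟩
    refine ⟨_, ?_, (hasLaplacianAt_lineAverage hD hD' (by fun_prop) hy.ne').add hB⟩
    have h1 := hmem (s := 1) (by norm_num) hy.le hxy
    have h2 := hmem (s := -1) (by norm_num) hy.le hxy
    rw [one_mul] at h1
    rw [neg_one_mul, ← sub_eq_add_neg] at h2
    have h3 : ‖(φ' (x + y + k) - φ' (x - y + k)) - (φ' (x + y + 0) - φ' (x - y + 0))‖ ≤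
        M * (2 * y) ^ α * ‖k - 0‖ := by
      refine Convex.norm_image_sub_le_of_norm_hasDerivWithin_le (s := uIcc 0 k)
        (f := fun τ => φ' (x + y + τ) - φ' (x - y + τ))
        (f' := fun τ => φ'' (x + y + τ) - φ'' (x - y + τ)) (fun τ _ => ?_) (fun τ hτ => ?_)
        (convex_uIcc _ _) left_mem_uIcc right_mem_uIcc
      · exact (((hφ' _).comp_const_add (x + y) τ).sub
          ((hφ' _).comp_const_add (x - y) τ)).hasDerivWithinAt
      · have hm : ∀ {z : ℝ}, z ∈ Icc (-1 : ℝ) 1 ∧ z + k ∈ Icc (-1 : ℝ) 1 →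
            z + τ ∈ Icc (-1 : ℝ) 1 := fun {z} hz => by
          rw [mem_uIcc] at hτ
          obtain ⟨⟨_, _⟩, ⟨_, _⟩⟩ := hz
          rcases hτ with ⟨_, _⟩ | ⟨_, _⟩ <;> constructor <;> linarith
        have h4 := hM _ (hm h1) _ (hm h2)
        rwa [show x + y + τ - (x - y + τ) = 2 * y by ring, abs_of_pos (by linarith : 0 < 2 * y)]
          at h4
    simp only [add_zero, sub_zero, Real.norm_eq_abs] at h3
    have h5 : -(M * (2 * y) ^ α * |k|) ≤ D' (x + y) - D' (x - y) := by
      have := (abs_le.1 h3).2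
      simp only [D']
      linarith
    have h6 : c * |k| * ((1 + α) * (α * y ^ (α - 1))) = M * (2 * y) ^ α * |k| / y := by
      rw [Real.mul_rpow (by norm_num) hy.le, Real.rpow_sub_one hy.ne', hc]
      field_simp
    have h7 : 2 / Real.pi ≤ 1 := (div_le_one Real.pi_pos).2 Real.two_le_pi
    have h8 : 0 < 2 / Real.pi := div_pos two_pos Real.pi_pos
    have h9 : -(M * (2 * y) ^ α * |k| / y) ≤ (D' (x + y) - D' (x - y)) / y := by
      rw [← neg_div]; gcongr
    have h10 : 0 ≤ M * (2 * y) ^ α * |k| / y := by positivity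
    simp only [zero_add, h6, ge_iff_le]
    nlinarith [mul_le_mul_of_nonneg_left h9 h8.le, mul_le_mul_of_nonneg_right h7 h10]
  · intro x y hy hxy
    have h1 : |lineAverage D (x, y)| ≤ 2 * (S * |k|) := by
      refine abs_lineAverage_le fun s hs => ?_
      have h2 := hmem (abs_le.2 hs) hy hxy
      have h3 := Convex.norm_image_sub_le_of_norm_hasDerivWithin_le (s := Icc (-1) 1)
        (fun z _ => (hφ z).hasDerivWithinAt) hS (convex_Icc _ _) h2.1 h2.2
      rw [add_sub_cancel_left, norm_sub_rev] at h3
      exact h3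
    have h4 : |c * |k| * y ^ (1 + α)| ≤ c * |k| := by
      rw [abs_of_nonneg (by positivity)]
      refine mul_le_of_le_one_right (by positivity) (Real.rpow_le_one hy ?_ (by linarith))
      linarith [abs_nonneg x, abs_nonneg k]
    have h5 := abs_add_le (lineAverage D (x, y)) (c * |k| * y ^ (1 + α))
    simp only
    nlinarith [abs_nonneg k]

/-- The real part of the principal branch of `(p.1 + i p.2) ^ (-1/2)`. -/
noncomputable def reInvSqrt (p : ℝ × ℝ) : ℝ := reSqrt p / √(p.1 ^ 2 + p.2 ^ 2)

theorem reInvSqrt_nonneg (p : ℝ × ℝ) : 0 ≤ reInvSqrt p :=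
  div_nonneg (reSqrt_nonneg p) (Real.sqrt_nonneg _)

theorem sqrt_sq_add_sq_pos {p : ℝ × ℝ} (hp : 0 < p.1) : 0 < √(p.1 ^ 2 + p.2 ^ 2) :=
  Real.sqrt_pos.2 (by positivity)

theorem continuousOn_reInvSqrt : ContinuousOn reInvSqrt {p | 0 < p.1} :=
  continuous_reSqrt.continuousOn.div (Continuous.continuousOn (by fun_prop))
    fun _ hp => (sqrt_sq_add_sq_pos hp).ne'

theorem reInvSqrt_zero_snd {x : ℝ} (hx : 0 < x) : reInvSqrt (x, 0) = (√x)⁻¹ := by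
  have h := Real.mul_self_sqrt hx.le
  have h0 := Real.sqrt_pos.2 hx
  rw [reInvSqrt, reSqrt_of_nonneg hx.le]
  simp only [ne_eq, OfNat.ofNat_ne_zero, not_false_eq_true, zero_pow, add_zero, Real.sqrt_sq hx.le]
  field_simp
  linarith

theorem le_reInvSqrt {p : ℝ × ℝ} {r : ℝ} (hp : 0 < p.1) (hr : √(p.1 ^ 2 + p.2 ^ 2) ≤ 2 * r) :
    1 ≤ 2 * reInvSqrt p * √r := by
  have h0 := sqrt_sq_add_sq_pos hp
  have h1 := reSqrt_sq p
  have hr0 : 0 < r := by linarith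
  have h2 : 0 ≤ 2 * reInvSqrt p * √r :=
    mul_nonneg (mul_nonneg two_pos.le (reInvSqrt_nonneg p)) (Real.sqrt_nonneg _)
  refine (pow_le_pow_iff_left₀ zero_le_one h2 two_ne_zero).1 ?_
  rw [mul_pow, mul_pow, Real.sq_sqrt hr0.le, reInvSqrt, div_pow, h1, one_pow]
  set R := √(p.1 ^ 2 + p.2 ^ 2)
  have h3 : 2 ^ 2 * ((R + p.1) / 2 / R ^ 2) * r = (R + p.1) * (2 * r) / R ^ 2 := by ring
  rw [h3, le_div_iff₀ (by positivity)]
  nlinarith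

theorem hasLaplacianAt_reInvSqrt {p : ℝ × ℝ} (hp : 0 < p.1) : HasLaplacianAt reInvSqrt 0 p := by
  have hfun : reInvSqrt = fun q : ℝ × ℝ => (((q.1 + q.2 * Complex.I : ℂ)) ^ (-2⁻¹ : ℂ)).re := by
    funext q
    have hsq : ∀ z : ℂ, (z ^ (2⁻¹ : ℂ)) ^ 2 = z := fun z => by simp
    have hn : Complex.normSq ((q.1 + q.2 * Complex.I : ℂ) ^ (2⁻¹ : ℂ)) = √(q.1 ^ 2 + q.2 ^ 2) := by
      rw [Complex.normSq_eq_norm_sq, ← norm_pow, hsq, Complex.norm_eq_sqrt_sq_add_sq]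
      simp
    rw [Complex.cpow_neg, Complex.inv_re, hn, re_cpow_half]
    simp [reInvSqrt]
  have hz : (p.1 + p.2 * Complex.I : ℂ) ∈ Complex.slitPlane := by
    rw [Complex.mem_slitPlane_iff]
    left
    simpa using hp
  rw [hfun]
  refine HasLaplacianAt.re_comp (F := fun z => z ^ (-2⁻¹ : ℂ))
    (F' := fun z => -2⁻¹ * z ^ (-2⁻¹ - 1 : ℂ) * 1) ?_
    (((hasDerivAt_id _).cpow_const hz).const_mul (-2⁻¹ : ℂ) |>.mul_const 1)
  filter_upwards [Complex.isOpen_slitPlane.mem_nhds hz] with z hz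
  exact (hasDerivAt_id z).cpow_const hz

theorem hasNormalDeriv_reInvSqrt {x : ℝ} (hx : 0 < x) : HasNormalDeriv reInvSqrt 0 x :=
  HasNormalDeriv.of_even ((differentiableAt_reSqrt hx).div (differentiableAt_sqrt_sq_add_sq hx)
    (sqrt_sq_add_sq_pos (p := (x, 0)) hx).ne') (fun s => by simp [reInvSqrt, reSqrt])

theorem two_mul_inv_sqrt_le {a x : ℝ} (hx : |x| < a) :
    2 * (√a)⁻¹ ≤ (√(a - x))⁻¹ + (√(a + x))⁻¹ := by
  obtain ⟨h1, h2⟩ := abs_lt.1 hx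
  have ha : 0 < a := by linarith
  have hp : 0 < √(a - x) := Real.sqrt_pos.2 (by linarith)
  have hq : 0 < √(a + x) := Real.sqrt_pos.2 (by linarith)
  refine (pow_le_pow_iff_left₀ (by positivity) (by positivity) two_ne_zero).1 ?_
  have h3 : √(a - x) * √(a + x) ≤ a := by
    rw [← Real.sqrt_mul (by linarith)]
    exact Real.sqrt_le_iff.2 ⟨ha.le, by nlinarith [sq_nonneg x]⟩
  have h4 : a⁻¹ ≤ (√(a - x))⁻¹ * (√(a + x))⁻¹ := by
    rw [← mul_inv]
    exact inv_anti₀ (by positivity) h3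
  rw [mul_pow, inv_pow, Real.sq_sqrt ha.le]
  nlinarith [sq_nonneg ((√(a - x))⁻¹ - (√(a + x))⁻¹)]

/-- An element of the barrier: sum of two singular functions with poles slightly outside the
disc `B_ρ`, at distance `a - ρ`. -/
noncomputable def poleBarrier (a x₀ : ℝ) (q : ℝ × ℝ) : ℝ :=
  reInvSqrt (-1 * q.1 + (a + x₀), q.2) + reInvSqrt (1 * q.1 + (a - x₀), q.2)

section poleBarrier

variable {a x₀ : ℝ}

theorem continuousOn_poleBarrier : ContinuousOn (poleBarrier a x₀) {q | |q.1 - x₀| < a} := by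
  refine ContinuousOn.add ?_ ?_
  · exact continuousOn_reInvSqrt.comp (f := fun q : ℝ × ℝ => (-1 * q.1 + (a + x₀), q.2))
      (Continuous.continuousOn (by fun_prop)) fun q hq => by
        have := abs_lt.1 (show |q.1 - x₀| < a from hq)
        show 0 < -1 * q.1 + (a + x₀); linarith
  · exact continuousOn_reInvSqrt.comp (f := fun q : ℝ × ℝ => (1 * q.1 + (a - x₀), q.2))
      (Continuous.continuousOn (by fun_prop)) fun q hq => by
        have := abs_lt.1 (show |q.1 - x₀| < a from hq)
        show 0 < 1 * q.1 + (a - x₀); linarith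

theorem hasLaplacianAt_poleBarrier {q : ℝ × ℝ} (hq : |q.1 - x₀| < a) :
    HasLaplacianAt (poleBarrier a x₀) 0 q := by
  have := abs_lt.1 hq
  refine (((hasLaplacianAt_reInvSqrt (p := (-1 * q.1 + (a + x₀), q.2)) ?_).comp_affine_fst
    (by norm_num)).add ((hasLaplacianAt_reInvSqrt (p := (1 * q.1 + (a - x₀), q.2))
    ?_).comp_affine_fst (by norm_num))).congr_laplacian (add_zero 0) <;>
  simp only <;> linarith

theorem hasNormalDeriv_poleBarrier {x : ℝ} (hx : |x - x₀| < a) :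
    HasNormalDeriv (poleBarrier a x₀) 0 x := by
  have := abs_lt.1 hx
  have h1 := (hasNormalDeriv_reInvSqrt (x := -1 * x + (a + x₀)) (by linarith)).comp_affine_fst.add
    (hasNormalDeriv_reInvSqrt (x := 1 * x + (a - x₀)) (by linarith)).comp_affine_fst
  rwa [add_zero] at h1

theorem poleBarrier_nonneg (q : ℝ × ℝ) : 0 ≤ poleBarrier a x₀ q :=
  add_nonneg (reInvSqrt_nonneg _) (reInvSqrt_nonneg _)

theorem poleBarrier_center (ha : 0 < a) : poleBarrier a x₀ (x₀, 0) = 2 * (√a)⁻¹ := by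
  have h1 : -1 * x₀ + (a + x₀) = a := by ring
  have h2 : 1 * x₀ + (a - x₀) = a := by ring
  rw [poleBarrier, h1, h2, reInvSqrt_zero_snd ha]
  ring

theorem le_poleBarrier_line {x : ℝ} (hx : |x - x₀| < a) :
    2 * (√a)⁻¹ ≤ poleBarrier a x₀ (x, 0) := by
  have := abs_lt.1 hx
  rw [poleBarrier, reInvSqrt_zero_snd (by simp only; linarith),
    reInvSqrt_zero_snd (by simp only; linarith)]
  convert two_mul_inv_sqrt_le hx using 4 <;> ring

theorem sqrt_sq_add_sq_le {x y : ℝ} (hx : 0 ≤ x) (hy : 0 ≤ y) : √(x ^ 2 + y ^ 2) ≤ x + y :=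
  Real.sqrt_le_iff.2 ⟨by positivity, by nlinarith [mul_nonneg hx hy]⟩

theorem le_poleBarrier_arc {ρ κ : ℝ} (hρ : 0 < ρ) (hκ : 0 < κ) {q : ℝ × ℝ}
    (hq : (q.1 - x₀) ^ 2 + q.2 ^ 2 = ρ ^ 2) (hq2 : 0 ≤ q.2) :
    1 ≤ 2 * poleBarrier (ρ + κ) x₀ q * √(κ + q.2) := by
  have h1 : |q.1 - x₀| ≤ ρ := abs_le_of_sq_le_sq (by nlinarith) hρ.le
  have h3 : q.2 ≤ ρ := (abs_le_of_sq_le_sq' (by nlinarith) hρ.le).2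
  have h2 : ρ - |q.1 - x₀| ≤ q.2 := by
    rw [← sq_abs] at hq
    nlinarith [abs_nonneg (q.1 - x₀)]
  have hs := Real.sqrt_nonneg (κ + q.2)
  have e1 := reInvSqrt_nonneg (-1 * q.1 + (ρ + κ + x₀), q.2)
  have e2 := reInvSqrt_nonneg (1 * q.1 + (ρ + κ - x₀), q.2)
  unfold poleBarrier
  rcases abs_cases (q.1 - x₀) with ⟨h4, -⟩ | ⟨h4, -⟩ <;> rw [h4] at h1 h2
  · have h5 : 0 < -1 * q.1 + (ρ + κ + x₀) := by linarith
    have h6 := le_reInvSqrt (p := (-1 * q.1 + (ρ + κ + x₀), q.2)) (r := κ + q.2) h5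
      ((sqrt_sq_add_sq_le h5.le hq2).trans (by linarith))
    nlinarith [mul_nonneg e2 hs]
  · have h5 : 0 < 1 * q.1 + (ρ + κ - x₀) := by linarith
    have h6 := le_reInvSqrt (p := (1 * q.1 + (ρ + κ - x₀), q.2)) (r := κ + q.2) h5
      ((sqrt_sq_add_sq_le h5.le hq2).trans (by linarith))
    nlinarith [mul_nonneg e1 hs]

end poleBarrier

set_option maxHeartbeats 1000000 in
/-- Comparison of a horizontal translate of a member of the family with a later member. -/
theorem IsThinFamily.translation_comparison {θ κ η : ℝ} {φ : ℝ → ℝ} {u : ℝ → ℝ × ℝ → ℝ}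
    (h : IsThinFamily θ κ η φ u) (hφ : IsC2Holder φ) {δ : ℝ} (hδ : 0 < δ) (hδ' : δ ≤ 1) :
    ∃ K > 0, ∃ k₀ > 0, ∀ k : ℝ, |k| ≤ k₀ → ∀ t ∈ Icc (-1 : ℝ) 1, ∀ t' ∈ Icc (-1 : ℝ) 1,
      t + K * |k| ≤ t' → ∀ x, |x| ≤ 1 - δ → u t (x + k, 0) - φ (x + k) ≤ u t' (x, 0) - φ x := by
  obtain ⟨M, hM0, hM⟩ := h.exists_bound
  obtain ⟨C₆, hC₆, hQ⟩ := hφ.exists_subharmonic_extension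
  have hθ := h.θ_pos
  have hη := h.η_pos
  set ρ := δ / 8 with hρδ
  have hρ : 0 < ρ := by positivity
  set C₅ := 4 * θ + 4 * M / ρ with hC₅
  have hC₅0 : 0 < C₅ := by positivity
  set C₁ := 2 * C₅ with hC₁
  set μ := 2 * (C₁ * (2 * (√ρ)⁻¹) + C₆) / ρ ^ 2 with hμ
  have hμ0 : 0 < μ := by positivity
  have hμρ : μ * ρ ^ 2 = 2 * (C₁ * (2 * (√ρ)⁻¹) + C₆) := by rw [hμ]; field_simp
  set T := C₅ * (√(ρ / 2))⁻¹ + C₆ + C₁ * (2 * (√ρ)⁻¹) + μ * ρ ^ 2 with hT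
  have hT0 : 0 < T := by positivity
  set K := 48 * T / (η * ρ) with hK
  have hK0 : 0 < K := by positivity
  have hKT : η / 24 * K * (ρ / 2) = T := by rw [hK]; field_simp; norm_num
  refine ⟨K, hK0, ρ, hρ, fun k hk t ht t' ht' htt x₁ hx₁ => ?_⟩
  rcases eq_or_ne k 0 with rfl | hk0
  · have := h.le_of_le ht ht' (by simpa using htt) (p := (x₁, 0))
      (by simp only; nlinarith [abs_le.1 (hx₁.trans (by linarith : 1 - δ ≤ 1))]) le_rfl
    simp only [add_zero]
    linarith
  have hkpos : 0 < |k| := abs_pos.2 hk0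
  have htt' : t ≤ t' := le_trans (by nlinarith) htt
  obtain ⟨Q, hQc, hQ0, hQn, hQl, hQb⟩ := hQ k
  have hρ1 : ρ ≤ 1 / 8 := by linarith
  have hsub : ∀ {q : ℝ × ℝ}, (q.1 - x₁) ^ 2 + q.2 ^ 2 - ρ ^ 2 ≤ 0 → 0 ≤ q.2 →
      q.1 ^ 2 + q.2 ^ 2 < 4 ∧ (1 * q.1 + k) ^ 2 + q.2 ^ 2 < 4 ∧ |q.1| ≤ 1 ∧ |q.1 + k| ≤ 1 ∧
      |q.1| + q.2 + |k| ≤ 1 ∧ |q.1| + 2 * ρ ≤ 1 ∧ q.2 ≤ ρ ∧ |q.1 - x₁| < ρ + |k| :=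
    fun {q} hq hq2 => by
      obtain ⟨h1, -, h2, h3⟩ := half_disc_subset (p := q) (hx₁.trans (by linarith)) hρ (by linarith)
        (by linarith)
      have h3 := (le_abs_self _).trans h3
      have h4 : |q.1| ≤ 1 - δ + ρ := by
        have := abs_add_le (q.1 - x₁) x₁
        rw [sub_add_cancel] at this
        linarith
      have h5 : |q.1 + k| ≤ 1 := (abs_add_le _ _).trans (by linarith)
      refine ⟨h1, ?_, by linarith, h5, by linarith, by linarith, h3, by linarith⟩
      rw [one_mul]
      have := abs_le.1 h5
      nlinarith
  set a := ρ + |k| with ha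
  have ha0 : 0 < a := by positivity
  have hea : (√a)⁻¹ ≤ (√ρ)⁻¹ := inv_anti₀ (Real.sqrt_pos.2 hρ) (Real.sqrt_le_sqrt (by linarith))
  have key := nonneg_of_superharmonic_region
    (A := fun p : ℝ × ℝ => (p.1 - x₁) ^ 2 + p.2 ^ 2 - ρ ^ 2)
    (g := fun q => (u t' q - u t (1 * q.1 + k, q.2) - Q q) +
      |k| * ((C₁ * poleBarrier a x₁ q + -μ * (q.2 ^ 2 - (q.1 - x₁) ^ 2)) +
        (-(C₁ * (2 * (√a)⁻¹)) + 0 * q.1))) (by fun_prop) 2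
    (half_disc_bound (hx₁.trans (by linarith)) hρ (by linarith)) ?_ ?_ ?_ ?_ (x₁, 0)
    (by simp; positivity) le_rfl
  · simp only [poleBarrier_center ha0, hQ0, one_mul] at key
    linarith
  · refine ContinuousOn.add (ContinuousOn.sub (ContinuousOn.sub ?_ ?_) hQc.continuousOn)
      (continuousOn_const.mul (ContinuousOn.add (ContinuousOn.add (continuousOn_const.mul ?_)
      (Continuous.continuousOn (by fun_prop))) (Continuous.continuousOn (by fun_prop))))
    · exact (h.sol t' ht').continuousOn.mono fun q hq => ⟨(hsub hq.1 hq.2).1.le, hq.2⟩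
    · exact (h.sol t ht).continuousOn.comp (f := fun q : ℝ × ℝ => (1 * q.1 + k, q.2))
        (Continuous.continuousOn (by fun_prop)) fun q hq => ⟨(hsub hq.1 hq.2).2.1.le, hq.2⟩
    · exact continuousOn_poleBarrier.mono fun q hq => (hsub hq.1 hq.2).2.2.2.2.2.2.2
  · intro q hq hq2
    obtain ⟨h1, h2, h3, h4, h5, h6, h7, h8⟩ := hsub hq.le hq2
    have hqe : (q.1 - x₁) ^ 2 + q.2 ^ 2 = ρ ^ 2 := by linarith
    have hw := h.lower_bound ht ht' htt' h1.le hq2 (by linarith)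
    have hQq := abs_le.1 (hQb q.1 q.2 hq2 h5)
    have hd := (h.sol t ht).abs_sub_le hθ.le (hM t ht) hρ (by linarith) h6 hq2 (by linarith) hk
    have hp := le_poleBarrier_arc hρ hkpos hqe hq2
    have hp0 : 0 ≤ poleBarrier a x₁ q := poleBarrier_nonneg q
    have hs : 0 < √(|k| + q.2) := Real.sqrt_pos.2 (by linarith)
    have hd2 : u t (1 * q.1 + k, q.2) - u t q ≤ C₅ * |k| * (√(|k| + q.2))⁻¹ := by
      rw [one_mul, ← div_eq_mul_inv, le_div_iff₀ hs]
      exact (mul_le_mul_of_nonneg_right (le_abs_self _) hs.le).trans hd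
    have hw2 : η / 24 * (K * |k|) * q.2 ≤ u t' q - u t q := by
      refine le_trans ?_ hw
      gcongr
      linarith
    show 0 ≤ (u t' q - u t (1 * q.1 + k, q.2) - Q q) +
      |k| * ((C₁ * poleBarrier a x₁ q + -μ * (q.2 ^ 2 - (q.1 - x₁) ^ 2)) +
        (-(C₁ * (2 * (√a)⁻¹)) + 0 * q.1))
    suffices hsuf : 0 ≤ η / 24 * K * q.2 - C₅ * (√(|k| + q.2))⁻¹ - C₆ +
        ((C₁ * poleBarrier a x₁ q + -μ * (q.2 ^ 2 - (q.1 - x₁) ^ 2)) - C₁ * (2 * (√ρ)⁻¹)) by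
      have e1 := mul_nonneg hkpos.le hsuf
      have e2 : C₁ * (2 * (√a)⁻¹) ≤ C₁ * (2 * (√ρ)⁻¹) := by gcongr
      have e3 := mul_le_mul_of_nonneg_left e2 hkpos.le
      have e4 : Q q ≤ C₆ * |k| := hQq.2
      linarith
    rcases le_total q.2 (ρ / 2) with hy | hy
    · have e1 : C₅ * (√(|k| + q.2))⁻¹ ≤ C₁ * poleBarrier a x₁ q := by
        rw [← div_eq_mul_inv, div_le_iff₀ hs]
        have := mul_le_mul_of_nonneg_left hp hC₅0.le
        linarith
      have e2 : μ * (ρ ^ 2 / 2) ≤ μ * ((q.1 - x₁) ^ 2 - q.2 ^ 2) :=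
        mul_le_mul_of_nonneg_left (by nlinarith) hμ0.le
      have e3 : 0 ≤ η / 24 * K * q.2 := by positivity
      linarith
    · have e1 : C₅ * (√(|k| + q.2))⁻¹ ≤ C₅ * (√(ρ / 2))⁻¹ := by
        gcongr
        linarith
      have e2 : μ * (-(ρ ^ 2)) ≤ μ * ((q.1 - x₁) ^ 2 - q.2 ^ 2) :=
        mul_le_mul_of_nonneg_left (by nlinarith) hμ0.le
      have e3 : η / 24 * K * (ρ / 2) ≤ η / 24 * K * q.2 := by gcongr
      have e4 : 0 ≤ C₁ * poleBarrier a x₁ q := by positivity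
      linarith
  · intro q hq hq2
    obtain ⟨h1, h2, h3, h4, h5, h6, h7, h8⟩ := hsub hq.le hq2.le
    obtain ⟨ℓ, hℓ, hQℓ⟩ := hQl q.1 q.2 hq2 h5
    refine ⟨_, ?_, ((((h.sol t' ht').laplacian q h1 hq2).sub
      (HasLaplacianAt.comp_affine_fst (x := q.1) (y := q.2) (one_pow 2)
        ((h.sol t ht).laplacian (1 * q.1 + k, q.2) h2 hq2))).sub hQℓ).add
      (HasLaplacianAt.const_mul |k| ((((hasLaplacianAt_poleBarrier h8).const_mul C₁).add
        (hasLaplacianAt_harmonic_quadratic x₁ (-μ) q)).add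
        ⟨_, _, HasSecondDerivAt.of_cubic (-(C₁ * (2 * (√a)⁻¹))) 0 0 0 (fun s => by ring),
          HasSecondDerivAt.of_cubic (-(C₁ * (2 * (√a)⁻¹))) 0 0 0 (fun s => by ring), rfl⟩))⟩
    linarith
  · intro x hx hneg
    obtain ⟨h1, h2, h3, h4, h5, h6, h7, h8⟩ := hsub hx.le le_rfl
    simp only [one_mul] at h2
    have e1 := le_poleBarrier_line h8
    have e2 : u t' (x, 0) - u t (x + k, 0) - (φ x - φ (x + k)) < 0 := by
      simp only [hQ0, one_mul] at hneg
      have e3 : 0 ≤ C₁ * poleBarrier a x₁ (x, 0) - C₁ * (2 * (√a)⁻¹) := by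
        rw [← mul_sub]; exact mul_nonneg (by positivity) (by linarith)
      have e4 : 0 ≤ μ * (x - x₁) ^ 2 := by positivity
      have e5 := mul_nonneg hkpos.le (add_nonneg e3 e4)
      linarith
    obtain ⟨L, hL, -, hLc⟩ := (h.sol t ht).normalDeriv (x + k) (by simpa using h2)
    obtain ⟨L', hL', -, hLc'⟩ := (h.sol t' ht').normalDeriv x (by simpa using h1)
    obtain ⟨b1, b2, b3⟩ := hLc h4
    obtain ⟨b1', b2', b3'⟩ := hLc' h3
    have hLL : L' ≤ L := by
      rcases lt_or_ge (u t' (x, 0)) (φ x) with h7 | h7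
      · rw [b3' h7]; exact (abs_le.1 b1).1
      · rw [b2 (by linarith)]; exact (abs_le.1 b1').2
    refine ⟨_, ?_, ((hL'.sub (HasNormalDeriv.comp_affine_fst (σ := 1) (c := k)
      (by rwa [one_mul]))).sub (hQn x)).add
      (HasNormalDeriv.const_mul |k| ((((hasNormalDeriv_poleBarrier h8).const_mul C₁).add
        (hasNormalDeriv_harmonic_quadratic x₁ (-μ) x)).add
        (HasNormalDeriv.of_cubic (-(C₁ * (2 * (√a)⁻¹))) 0 0 0 (fun s => by ring))))⟩
    linarith

theorem volume_image_eq_zero_of_lipschitzOnWith {f : ℝ → ℝ} {K : NNReal} {s : Set ℝ}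
    (hf : LipschitzOnWith K f s) (hs : volume s = 0) : volume (f '' s) = 0 := by
  have h := hf.hausdorffMeasure_image_le (d := 1) zero_le_one
  rw [hausdorffMeasure_real, hs, mul_zero] at h
  exact le_antisymm h zero_le

/-- The one-dimensional Sard theorem for Lipschitz functions. -/
theorem volume_image_critical_Ioo_eq_zero {f : ℝ → ℝ} {K : NNReal} {c d : ℝ}
    (hf : LipschitzOnWith K f (Ioo c d)) :
    volume (f '' {x ∈ Ioo c d | ¬∃ β ≠ 0, HasDerivAt f β x}) = 0 := by
  have hsub : {x ∈ Ioo c d | ¬∃ β ≠ 0, HasDerivAt f β x} ⊆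
      {x ∈ Ioo c d | ¬DifferentiableAt ℝ f x} ∪ {x ∈ Ioo c d | HasDerivAt f 0 x} := by
    rintro x ⟨hx, h⟩
    by_cases hd : DifferentiableAt ℝ f x
    · by_cases h0 : deriv f x = 0
      · exact Or.inr ⟨hx, h0 ▸ hd.hasDerivAt⟩
      · exact absurd ⟨_, h0, hd.hasDerivAt⟩ h
    · exact Or.inl ⟨hx, hd⟩
  refine measure_mono_null (image_mono hsub) ?_
  rw [image_union]
  refine measure_union_null ?_ ?_
  · refine volume_image_eq_zero_of_lipschitzOnWith (hf.mono fun x hx => hx.1) ?_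
    have h := hf.ae_differentiableWithinAt_of_mem_real
    rw [ae_iff] at h
    refine measure_mono_null (fun x hx => ?_) h
    exact fun h => hx.2 ((h hx.1).differentiableAt (Ioo_mem_nhds hx.1.1 hx.1.2))
  · refine addHaar_image_eq_zero_of_det_fderivWithin_eq_zero volume
      (f' := fun _ => (0 : ℝ →L[ℝ] ℝ)) (fun x hx => ?_) (fun x _ => ?_)
    · simpa using hx.2.hasFDerivAt.hasFDerivWithinAt
    · simp

theorem volume_image_critical_eq_zero {f : ℝ → ℝ} {s : Set ℝ}
    (hf : ∀ x ∈ s, ∃ K, ∃ ε > 0, LipschitzOnWith K f (Ioo (x - ε) (x + ε))) :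
    volume (f '' {x ∈ s | ¬∃ β ≠ 0, HasDerivAt f β x}) = 0 := by
  choose! K ε hε hK using hf
  obtain ⟨T, hT, hTc, hcov⟩ := TopologicalSpace.countable_cover_nhdsWithin
    (s := s) (f := fun x => Ioo (x - ε x) (x + ε x)) fun x hx =>
      mem_nhdsWithin_of_mem_nhds (Ioo_mem_nhds (by linarith [hε x hx]) (by linarith [hε x hx]))
  refine measure_mono_null (t := ⋃ x ∈ T,
    f '' {y ∈ Ioo (x - ε x) (x + ε x) | ¬∃ β ≠ 0, HasDerivAt f β y}) ?_ ?_
  · rintro _ ⟨y, ⟨hy, hy'⟩, rfl⟩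
    obtain ⟨x, hx, hxy⟩ := mem_iUnion₂.1 (hcov hy)
    exact mem_iUnion₂.2 ⟨x, hx, y, ⟨hxy, hy'⟩, rfl⟩
  · exact (measure_biUnion_null_iff hTc).2 fun x hx =>
      volume_image_critical_Ioo_eq_zero (hK x (hT hx))

/-- The last time at which `u t` lies below the obstacle at `x`. -/
noncomputable def contactTime (φ : ℝ → ℝ) (u : ℝ → ℝ × ℝ → ℝ) (x : ℝ) : ℝ :=
  sSup (insert (-1) {t ∈ Icc (-1 : ℝ) 1 | u t (x, 0) ≤ φ x})

namespace IsThinFamily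

variable {θ κ η : ℝ} {φ : ℝ → ℝ} {u : ℝ → ℝ × ℝ → ℝ}

theorem bddAbove_contactTime_set (φ : ℝ → ℝ) (u : ℝ → ℝ × ℝ → ℝ) (x : ℝ) :
    BddAbove (insert (-1) {t ∈ Icc (-1 : ℝ) 1 | u t (x, 0) ≤ φ x}) := by
  refine ⟨1, ?_⟩
  rintro t (rfl | ht)
  · norm_num
  · exact ht.1.2

theorem neg_one_le_contactTime (φ : ℝ → ℝ) (u : ℝ → ℝ × ℝ → ℝ) (x : ℝ) :
    -1 ≤ contactTime φ u x :=
  le_csSup (bddAbove_contactTime_set φ u x) (mem_insert _ _)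

theorem contactTime_le_one (φ : ℝ → ℝ) (u : ℝ → ℝ × ℝ → ℝ) (x : ℝ) :
    contactTime φ u x ≤ 1 := by
  refine csSup_le (insert_nonempty _ _) ?_
  rintro t (rfl | ht)
  · norm_num
  · exact ht.1.2

theorem le_of_lt_contactTime (h : IsThinFamily θ κ η φ u) {x t : ℝ} (hx : |x| ≤ 1)
    (ht : -1 ≤ t) (htx : t < contactTime φ u x) : u t (x, 0) ≤ φ x := by
  obtain ⟨s, hs | hs, hts⟩ := exists_lt_of_lt_csSup (insert_nonempty _ _) htx
  · exact absurd (hs ▸ hts) (not_lt.2 ht)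
  · refine (h.le_of_le ⟨ht, hts.le.trans hs.1.2⟩ hs.1 hts.le ?_ le_rfl).trans hs.2
    have := abs_le.1 hx
    simp only
    nlinarith

theorem lt_of_contactTime_lt {x t : ℝ} (ht : t ≤ 1) (htx : contactTime φ u x < t) :
    φ x < u t (x, 0) := by
  by_contra! hc
  have ht' : t ∈ Icc (-1 : ℝ) 1 := ⟨(neg_one_le_contactTime φ u x).trans htx.le, ht⟩
  exact htx.not_ge (le_csSup (bddAbove_contactTime_set φ u x) (Or.inr ⟨ht', hc⟩))

theorem contactTime_le_add (h : IsThinFamily θ κ η φ u) (hφ : IsC2Holder φ) {δ : ℝ} (hδ : 0 < δ)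
    (hδ' : δ ≤ 1) : ∃ K > 0, ∃ k₀ > 0, ∀ k, |k| ≤ k₀ → ∀ x, |x| ≤ 1 - δ →
      contactTime φ u x ≤ contactTime φ u (x + k) + K * |k| := by
  obtain ⟨K, hK, k₀, hk₀, H⟩ := h.translation_comparison hφ hδ hδ'
  refine ⟨K, hK, k₀, hk₀, fun k hk x hx => ?_⟩
  by_contra! hc
  obtain ⟨t, ht1, ht2⟩ := exists_between (show contactTime φ u (x + k) <
    contactTime φ u x - K * |k| by linarith)
  have h0 : 0 ≤ K * |k| := by positivity
  have h1 := neg_one_le_contactTime φ u (x + k)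
  have h2 := contactTime_le_one φ u x
  have h3 := H k hk t ⟨by linarith, by linarith⟩ (t + K * |k|) ⟨by linarith, by linarith⟩ le_rfl x hx
  have h4 := h.le_of_lt_contactTime (x := x) (t := t + K * |k|) (by linarith) (by linarith)
    (by linarith)
  have h5 := lt_of_contactTime_lt (φ := φ) (u := u) (x := x + k) (t := t) (by linarith) ht1
  linarith

theorem exists_lipschitzOnWith_contactTime (h : IsThinFamily θ κ η φ u) (hφ : IsC2Holder φ)
    {x : ℝ} (hx : x ∈ Ioo (-1 : ℝ) 1) :
    ∃ K, ∃ ε > 0, LipschitzOnWith K (contactTime φ u) (Ioo (x - ε) (x + ε)) := by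
  have hx' : |x| < 1 := abs_lt.2 hx
  obtain ⟨K, hK, k₀, hk₀, H⟩ := h.contactTime_le_add hφ (δ := (1 - |x|) / 2) (by linarith)
    (by linarith [abs_nonneg x])
  refine ⟨⟨K, hK.le⟩, min ((1 - |x|) / 2) (k₀ / 2), lt_min (by linarith) (by linarith), ?_⟩
  refine LipschitzOnWith.of_le_add_mul _ fun y hy z hz => ?_
  have e1 := min_le_left ((1 - |x|) / 2) (k₀ / 2)
  have e2 := min_le_right ((1 - |x|) / 2) (k₀ / 2)
  have := H (z - y) (abs_le.2 ⟨by linarith [hy.2, hz.1], by linarith [hy.1, hz.2]⟩) y ?_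
  · rwa [add_sub_cancel, ← Real.dist_eq, dist_comm] at this
  · have h1 : |y - x| ≤ (1 - |x|) / 2 := abs_le.2 ⟨by linarith [hy.1], by linarith [hy.2]⟩
    have h2 := abs_add_le (y - x) x
    rw [sub_add_cancel] at h2
    linarith

theorem ae_hasDerivAt_contactTime (h : IsThinFamily θ κ η φ u) (hφ : IsC2Holder φ) :
    ∀ᵐ t : ℝ, ∀ x ∈ Ioo (-1 : ℝ) 1, contactTime φ u x = t →
      ∃ β ≠ 0, HasDerivAt (contactTime φ u) β x := by
  have := volume_image_critical_eq_zero
    fun x hx => h.exists_lipschitzOnWith_contactTime hφ (x := x) hx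
  rw [← compl_mem_ae_iff] at this
  filter_upwards [this] with t ht x hx hxt
  by_contra hc
  exact ht ⟨x, ⟨hx, hc⟩, hxt⟩

end IsThinFamily

theorem reSqrt_lower_bound {a y s : ℝ} (h : a ^ 2 + y ^ 2 = (s ^ 2) ^ 2)
    (hy : s ^ 2 / 2 ≤ y) : s / 4 ≤ reSqrt (a, y) := by
  refine abs_le_of_sq_le_sq' ?_ (reSqrt_nonneg _) |>.2
  have h1 : √(a ^ 2 + y ^ 2) = s ^ 2 := by rw [h]; exact Real.sqrt_sq (sq_nonneg s)
  rw [reSqrt_sq]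
  simp only [h1]
  have h2 : -(7 / 8 * s ^ 2) ≤ a := abs_le_of_sq_le_sq' (by nlinarith [sq_nonneg s]) (by positivity)
    |>.1
  nlinarith

/-- If a solution is not too small on a half circle, it detaches from the obstacle inside. -/
theorem IsThinSolution.obstacle_lt_of_arc {θ κ : ℝ} {φ φ' φ'' : ℝ → ℝ} {u : ℝ × ℝ → ℝ}
    (h : IsThinSolution θ κ φ u) (h1 : ∀ x, HasDerivAt φ (φ' x) x)
    (h2 : ∀ x, HasDerivAt φ' (φ'' x) x) {N : ℝ} (hN : ∀ x, |x| ≤ 3 / 2 → |φ'' x| ≤ N)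
    {x₀ r C : ℝ} (hx₀ : |x₀| + r ≤ 1) (hr : 0 < r) (hr' : r ≤ 1 / 2) (hC : 0 < C)
    (hlow : ∀ p : ℝ × ℝ, (p.1 - x₀) ^ 2 + p.2 ^ 2 = r ^ 2 → 0 ≤ p.2 →
      -(C * r ^ 2) ≤ u p - φ p.1 - θ * p.2)
    (hhigh : ∀ p : ℝ × ℝ, (p.1 - x₀) ^ 2 + p.2 ^ 2 = r ^ 2 → r / 2 ≤ p.2 →
      6 * (C + N) * r ^ 2 ≤ u p - φ p.1 - θ * p.2) {x : ℝ} (hx : |x - x₀| ≤ r / 4) :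
    φ x < u (x, 0) := by
  have hx₀' : |x₀| ≤ 1 := by linarith
  have hN0 : 0 ≤ N := (abs_nonneg _).trans (hN x₀ (by linarith))
  set D := C + N with hD
  have hD0 : 0 < D := by positivity
  have hsub : ∀ {q : ℝ × ℝ}, (q.1 - x₀) ^ 2 + q.2 ^ 2 - r ^ 2 ≤ 0 → q.1 ^ 2 + q.2 ^ 2 < 4 ∧
      |q.1| ≤ 3 / 2 ∧ |q.1 - x₀| ≤ r ∧ |q.2| ≤ r := fun {q} hq =>
    half_disc_subset hx₀' hr hr' (p := q) (by linarith)
  have key := nonneg_of_superharmonic_region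
    (A := fun p : ℝ × ℝ => (p.1 - x₀) ^ 2 + p.2 ^ 2 - r ^ 2)
    (g := fun p => u p + (-1) * φ p.1 + (-(θ * p.2) - N / 2 * p.2 ^ 2 + D * r ^ 2 -
      4 * D * (p.2 ^ 2 - (p.1 - x₀) ^ 2 + r ^ 2 / 2))) (by fun_prop) 2
    (half_disc_bound hx₀' hr hr') ?_ ?_ ?_ ?_ (x, 0) ?_ le_rfl
  · have hsq := sq_le_sq' (by linarith [abs_nonneg (x - x₀)]) hx
    rw [sq_abs] at hsq
    simp only at key
    nlinarith [mul_le_mul_of_nonneg_left hsq hD0.le, mul_pos hD0 (pow_pos hr 2)]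
  · have hφc : Continuous φ := continuous_iff_continuousAt.2 fun x => (h1 x).continuousAt
    refine ((h.continuousOn.mono fun q hq => ⟨(hsub hq.1).1.le, hq.2⟩).add
      (Continuous.continuousOn ?_)).add (Continuous.continuousOn ?_) <;> fun_prop
  · intro p hp hp2
    have hp' : (p.1 - x₀) ^ 2 + p.2 ^ 2 = r ^ 2 := by simpa using sub_eq_zero.1 hp
    have hX : (p.1 - x₀) ^ 2 = r ^ 2 - p.2 ^ 2 := by linarith
    rw [hX]
    rcases le_total (r / 2) p.2 with hy | hy
    · have h3 := hhigh p hp' hy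
      have h4 : p.2 ^ 2 ≤ r ^ 2 := by nlinarith [sq_nonneg (p.1 - x₀)]
      nlinarith [mul_le_mul_of_nonneg_left h4 hD0.le, mul_le_mul_of_nonneg_left h4 hN0,
        mul_pos hC (pow_pos hr 2)]
    · have h3 := hlow p hp' hp2
      have h4 : p.2 ^ 2 ≤ r ^ 2 / 4 := by nlinarith
      nlinarith [mul_le_mul_of_nonneg_left h4 hD0.le, mul_le_mul_of_nonneg_left h4 hN0,
        mul_nonneg hN0 (pow_pos hr 2).le]
  · intro p hp hp2
    have hp' := hsub (q := p) hp.le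
    have hφ2 : HasLaplacianAt (fun q : ℝ × ℝ => φ q.1) (φ'' p.1 + (2 * 0 + 6 * 0 * p.2)) p :=
      ⟨_, _, ⟨φ', Eventually.of_forall h1, h2 p.1⟩,
        HasSecondDerivAt.of_cubic (φ p.1) 0 0 0 (fun s => by ring), rfl⟩
    refine ⟨_, ?_, ((h.laplacian p hp'.1 hp2).add (hφ2.const_mul (-1))).add
      ⟨_, _, HasSecondDerivAt.of_cubic (-(θ * p.2) - N / 2 * p.2 ^ 2 + D * r ^ 2 -
        4 * D * (p.2 ^ 2 - x₀ ^ 2 + r ^ 2 / 2)) (-8 * D * x₀) (4 * D) 0 (fun s => by ring),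
        HasSecondDerivAt.of_cubic (D * r ^ 2 + 4 * D * (p.1 - x₀) ^ 2 - 4 * D * (r ^ 2 / 2)) (-θ)
        (-(N / 2) - 4 * D) 0 (fun s => by ring), rfl⟩⟩
    have := (abs_le.1 (hN p.1 hp'.2.1)).1
    linarith
  · intro y hy _
    have hy' := hsub (q := (y, 0)) hy.le
    simp only [ne_eq, OfNat.ofNat_ne_zero, not_false_eq_true, zero_pow, add_zero] at hy'
    have hy1 : |y| ≤ 1 := by
      have := abs_add_le (y - x₀) x₀
      rw [sub_add_cancel] at this
      linarith
    obtain ⟨L, hL, -, hL'⟩ := h.normalDeriv y hy'.1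
    refine ⟨_, ?_, (hL.add ((HasNormalDeriv.of_cubic (φ y) 0 0 0 (g := fun q => φ q.1)
      (fun s => by ring)).const_mul (-1))).add
      (HasNormalDeriv.of_cubic (D * r ^ 2 + 4 * D * (y - x₀) ^ 2 - 4 * D * (r ^ 2 / 2)) (-θ)
        (-(N / 2) - 4 * D) 0 (fun s => by ring))⟩
    have := (abs_le.1 (hL' hy1).1).2
    linarith
  · have hsq := sq_le_sq' (by linarith [abs_nonneg (x - x₀)]) hx
    rw [sq_abs] at hsq
    simp only
    nlinarith

namespace IsThinFamily

variable {θ κ η : ℝ} {φ : ℝ → ℝ} {u : ℝ → ℝ × ℝ → ℝ}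

theorem contactTime_eq_of_quadratic (h : IsThinFamily θ κ η φ u) {t x₀ C ρ : ℝ}
    (ht : t ∈ Icc (-1 : ℝ) 1) (hx₀ : |x₀| ≤ 1) (hρ : 0 < ρ) (hc : u t (x₀, 0) = φ x₀)
    (hq : ∀ p : ℝ × ℝ, 0 ≤ p.2 → (p.1 - x₀) ^ 2 + p.2 ^ 2 < ρ ^ 2 →
      -(C * ((p.1 - x₀) ^ 2 + p.2 ^ 2)) ≤ u t p - φ p.1 - θ * p.2) :
    contactTime φ u x₀ = t := by
  refine le_antisymm ?_ (le_csSup (bddAbove_contactTime_set φ u x₀) (Or.inr ⟨ht, hc.le⟩))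
  by_contra! hlt
  obtain ⟨t', h1, h2⟩ := exists_between hlt
  have ht' : t' ∈ Icc (-1 : ℝ) 1 := ⟨by linarith [ht.1], h2.le.trans (contactTime_le_one φ u x₀)⟩
  have hx4 : x₀ ^ 2 ≤ 1 := by rw [sq_le_one_iff_abs_le_one]; exact hx₀
  have h3 := h.le_of_lt_contactTime hx₀ ht'.1 h2
  obtain ⟨L, hL, -, hL'⟩ := (h.sol t' ht').normalDeriv x₀ (by linarith)
  have hLθ := (abs_le.1 (hL' hx₀).1).2
  have hlim : Tendsto (fun s : ℝ => θ + η / 24 * (t' - t) - C * s) (𝓝[>] 0)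
      (𝓝 (θ + η / 24 * (t' - t) - C * 0)) :=
    (Continuous.tendsto (by fun_prop) 0).mono_left nhdsWithin_le_nhds
  have hle := le_of_tendsto_of_tendsto hlim hL ?_
  · have := mul_pos h.η_pos (sub_pos.2 h1)
    linarith
  · filter_upwards [Ioo_mem_nhdsGT (lt_min hρ one_pos)] with s hs
    have hs' := lt_min_iff.1 hs.2
    have h4 := hq (x₀, s) hs.1.le (by simp only; nlinarith [hs.1])
    have h5 := h.lower_bound ht ht' h1.le (p := (x₀, s)) (by simp only; nlinarith [hs.1]) hs.1.le
      (by simp only; linarith)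
    rw [le_div_iff₀ hs.1]
    simp only at h4 h5
    nlinarith

/-- Detachment at scale `s ^ 2` after time `O(s ^ 3)` near a point with a one-sided quadratic bound,
provided that there is no contact on one side of the point. -/
theorem exists_obstacle_lt_of_quadratic (h : IsThinFamily θ κ η φ u) (hφ : IsC2Holder φ)
    {t x₀ C ρ σ : ℝ} (ht : t ∈ Ioo (-1 : ℝ) 1) (hx₀ : |x₀| < 1) (hρ : 0 < ρ) (hC : 0 < C)
    (hσ : σ ^ 2 = 1)
    (hq : ∀ p : ℝ × ℝ, 0 ≤ p.2 → (p.1 - x₀) ^ 2 + p.2 ^ 2 < ρ ^ 2 →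
      -(C * ((p.1 - x₀) ^ 2 + p.2 ^ 2)) ≤ u t p - φ p.1 - θ * p.2)
    (hside : ∀ x, 0 < σ * (x - x₀) → |x - x₀| < ρ → φ x < u t (x, 0)) :
    ∃ E > 0, ∃ s₀ > 0, ∀ s ∈ Ioo 0 s₀, t + E * s ^ 3 ≤ 1 ∧
      ∀ x, |x - x₀| ≤ s ^ 2 / 4 → |x| ≤ 1 ∧ φ x < u (t + E * s ^ 3) (x, 0) := by
  obtain ⟨φ', φ'', -, -, -, h1, h2, h3, -⟩ := hφ
  obtain ⟨N, hN⟩ := isCompact_Icc.exists_bound_of_continuousOn (s := Icc (-(3 / 2) : ℝ) (3 / 2))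
    h3.continuousOn
  replace hN : ∀ x, |x| ≤ 3 / 2 → |φ'' x| ≤ N := fun x hx => hN x (abs_le.1 hx)
  have hN0 : 0 ≤ N := (abs_nonneg _).trans (hN 0 (by norm_num))
  set ρ' := min (min ρ (1 / 2)) (1 - |x₀|) with hρ'
  have hρ'0 : 0 < ρ' := lt_min (lt_min hρ (by norm_num)) (by linarith)
  have hρ1 : ρ' ≤ ρ := (min_le_left _ _).trans (min_le_left _ _)
  have hρ2 : ρ' ≤ 1 / 2 := (min_le_left _ _).trans (min_le_right _ _)
  have hρ3 : ρ' ≤ 1 - |x₀| := min_le_right _ _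
  set m := η * √ρ' / 144 with hm
  have hm0 : 0 < m := by have := h.η_pos; have := Real.sqrt_pos.2 hρ'0; positivity
  set B := 2 * √ρ' / ρ' ^ 2 with hB
  have hB0 : 0 ≤ B := by positivity
  set E := 56 * (C + N) / m with hE
  have hE0 : 0 < E := by positivity
  have hEm : E * m = 56 * (C + N) := by rw [hE]; field_simp
  have htpos : 0 < 1 - t := by linarith [ht.2]
  refine ⟨E, hE0, min (min (ρ' / 2) ((1 - t) / E)) (1 / (8 * (B + 1))),
    lt_min (lt_min (by linarith) (by positivity)) (by positivity), fun s hs => ?_⟩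
  obtain ⟨hs12, hs3⟩ := lt_min_iff.1 hs.2
  obtain ⟨hs1, hs2⟩ := lt_min_iff.1 hs12
  have hs0 := hs.1
  rw [lt_div_iff₀ (by positivity)] at hs2 hs3
  have hslt1 : s < 1 := by linarith
  have hss : s ^ 2 < s := by nlinarith
  have hs3s : s ^ 3 ≤ s := by nlinarith
  have hs23 : s ^ 3 ≤ s ^ 2 := by nlinarith [sq_nonneg s]
  have htE : t + E * s ^ 3 ≤ 1 := by nlinarith
  have hE3 : 0 < E * s ^ 3 := by positivity
  have htI : t ∈ Icc (-1 : ℝ) 1 := ⟨ht.1.le, ht.2.le⟩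
  have ht'I : t + E * s ^ 3 ∈ Icc (-1 : ℝ) 1 := ⟨by linarith [ht.1], htE⟩
  have hmonot : ∀ p : ℝ × ℝ, p.1 ^ 2 + p.2 ^ 2 ≤ 4 → 0 ≤ p.2 → u t p ≤ u (t + E * s ^ 3) p :=
    fun p hp hp2 => h.le_of_le htI ht'I (by linarith) hp hp2
  have hρs : s ^ 2 < ρ' := by linarith
  have hnear : ∀ p : ℝ × ℝ, (p.1 - x₀) ^ 2 + p.2 ^ 2 = (s ^ 2) ^ 2 →
      (p.1 - x₀) ^ 2 + p.2 ^ 2 < ρ' ^ 2 := fun p hp => by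
    rw [hp]; exact pow_lt_pow_left₀ hρs (by positivity) two_ne_zero
  have hlow : ∀ p : ℝ × ℝ, (p.1 - x₀) ^ 2 + p.2 ^ 2 = (s ^ 2) ^ 2 → 0 ≤ p.2 →
      -(C * (s ^ 2) ^ 2) ≤ u t p - φ p.1 - θ * p.2 := fun p hp hp2 => by
    have := hq p hp2 ((hnear p hp).trans_le (pow_le_pow_left₀ hρ'0.le hρ1 2))
    rwa [hp] at this
  refine ⟨htE, fun x hx => ⟨?_, (h.sol _ ht'I).obstacle_lt_of_arc h1 h2 hN (x₀ := x₀) (r := s ^ 2)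
    (C := C) (by linarith) (by positivity) (by linarith) hC (fun p hp hp2 => ?_)
    (fun p hp hp2 => ?_) hx⟩⟩
  · have := abs_add_le (x - x₀) x₀
    rw [sub_add_cancel] at this
    linarith [sq_nonneg s]
  · have h4 := half_disc_subset (x₀ := x₀) hx₀.le hρ'0 hρ2 (hnear p hp).le
    linarith [hlow p hp hp2, hmonot p h4.1.le hp2]
  · have hp20 : 0 ≤ p.2 := by nlinarith [sq_nonneg s]
    have h4 := h.sqrt_lower_bound htI ht'I (by linarith) hx₀.le hσ hρ'0 hρ2 (fun y hy hy' => ?_)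
      (hnear p hp).le hp20
    · rw [← hm, ← hB] at h4
      have h5 : s / 4 ≤ reSqrt (σ * p.1 + -(σ * x₀), p.2) := by
        refine reSqrt_lower_bound ?_ hp2
        have : (σ * p.1 + -(σ * x₀)) ^ 2 = σ ^ 2 * (p.1 - x₀) ^ 2 := by ring
        rw [this, hσ, one_mul, hp]
      have h6 : B * (p.1 - x₀) ^ 2 ≤ s / 8 := by
        have h61 : (s ^ 2) ^ 2 ≤ s ^ 2 := by
          rw [sq (s ^ 2)]
          exact mul_le_of_le_one_left (by positivity) (by linarith)
        have h62 : (p.1 - x₀) ^ 2 ≤ s ^ 2 := by linarith [sq_nonneg p.2]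
        have h63 := mul_le_mul_of_nonneg_left h62 hB0
        have h64 : s * (8 * B * s) ≤ s * 1 := mul_le_mul_of_nonneg_left (by linarith) hs0.le
        linarith
      have h7 : s / 8 ≤ reSqrt (σ * p.1 + -(σ * x₀), p.2) + B * (p.2 ^ 2 - (p.1 - x₀) ^ 2) := by
        linarith [mul_nonneg hB0 (sq_nonneg p.2)]
      have h8 : m * (t + E * s ^ 3 - t) * (s / 8) = 7 * (C + N) * (s ^ 2) ^ 2 := by
        linear_combination (s ^ 4 / 8) * hEm
      have h9 := mul_le_mul_of_nonneg_left h7 (show 0 ≤ m * (t + E * s ^ 3 - t) by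
        rw [add_sub_cancel_left]; positivity)
      have h10 := hlow p hp hp20
      have h11 : 0 ≤ N * (s ^ 2) ^ 2 := by positivity
      linarith
    · have hy1 : |y| ≤ 1 := by
        have := abs_add_le (y - x₀) x₀
        rw [sub_add_cancel] at this
        linarith
      have hy4 : y ^ 2 ≤ 1 := by rw [sq_le_one_iff_abs_le_one]; exact hy1
      have h5 := hside y hy (by linarith)
      have h6 := hmonot (y, 0) (by simp only; linarith) le_rfl
      obtain ⟨L, hL, -, hL'⟩ := (h.sol t htI).normalDeriv y (by linarith)
      obtain ⟨M, hM, -, hM'⟩ := (h.sol _ ht'I).normalDeriv y (by linarith)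
      exact ⟨θ, (hL' hy1).2.1 h5 ▸ hL, (hM' hy1).2.1 (h5.trans_le h6) ▸ hM⟩

theorem not_hasDerivAt_contactTime (h : IsThinFamily θ κ η φ u) (hφ : IsC2Holder φ)
    {t x₀ C ρ σ β : ℝ} (ht : t ∈ Ioo (-1 : ℝ) 1) (hx₀ : |x₀| < 1) (hρ : 0 < ρ) (hC : 0 < C)
    (hσ : σ ^ 2 = 1)
    (hq : ∀ p : ℝ × ℝ, 0 ≤ p.2 → (p.1 - x₀) ^ 2 + p.2 ^ 2 < ρ ^ 2 →
      -(C * ((p.1 - x₀) ^ 2 + p.2 ^ 2)) ≤ u t p - φ p.1 - θ * p.2)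
    (hb : contactTime φ u x₀ = t) (hβ : σ * β < 0) : ¬HasDerivAt (contactTime φ u) β x₀ := by
  intro hd
  rw [hasDerivAt_iff_isLittleO, Asymptotics.isLittleO_iff] at hd
  have hσ1 : |σ| = 1 := by rw [← abs_one, ← sq_eq_sq_iff_abs_eq_abs, hσ, one_pow]
  have hβ2 : 0 < -(σ * β) / 2 := by linarith
  obtain ⟨ε, hε, hd⟩ := Metric.eventually_nhds_iff.1 (hd hβ2)
  have hd' : ∀ k, |k| < ε → |contactTime φ u (x₀ + σ * k) - t - σ * β * k| ≤ -(σ * β) / 2 * |k| := by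
    intro k hk
    have hσk : |σ * k| = |k| := by rw [abs_mul, hσ1, one_mul]
    have := @hd (x₀ + σ * k) (by rwa [Real.dist_eq, add_sub_cancel_left, hσk])
    simp only [add_sub_cancel_left, smul_eq_mul, Real.norm_eq_abs, hb, hσk] at this
    rwa [show σ * β * k = σ * k * β by ring]
  obtain ⟨E, hE, s₀, hs₀, H⟩ := h.exists_obstacle_lt_of_quadratic hφ (ρ := min ρ ε) ht hx₀
    (lt_min hρ hε) hC hσ (fun p hp hp2 => hq p hp (hp2.trans_le
      (pow_le_pow_left₀ (lt_min hρ hε).le (min_le_left _ _) 2))) (fun x hx hx' => by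
    refine lt_of_contactTime_lt ht.2.le ?_
    have h1 := hd' (σ * (x - x₀)) (by
      rw [abs_mul, hσ1, one_mul]
      exact hx'.trans_le (min_le_right _ _))
    rw [show x₀ + σ * (σ * (x - x₀)) = x by linear_combination (x - x₀) * hσ, abs_of_pos hx] at h1
    nlinarith [(abs_le.1 h1).2, mul_pos hβ2 hx])
  obtain ⟨s, hs, hs'⟩ := exists_between
    (show (0 : ℝ) < min (min s₀ 1) (min ε (-(σ * β) / 2 / (4 * E))) from
      lt_min (lt_min hs₀ one_pos) (lt_min hε (by positivity)))
  obtain ⟨hs12, hs34⟩ := lt_min_iff.1 hs'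
  obtain ⟨hs1, hs2⟩ := lt_min_iff.1 hs12
  obtain ⟨hs3, hs4⟩ := lt_min_iff.1 hs34
  rw [lt_div_iff₀ (by positivity)] at hs4
  obtain ⟨h1, h2⟩ := H s ⟨hs, hs1⟩
  have hk : |-(s ^ 2 / 4)| = s ^ 2 / 4 := by rw [abs_neg, abs_of_pos (by positivity)]
  have h3 := hd' (-(s ^ 2 / 4)) (by rw [hk]; nlinarith)
  have h4 := h2 (x₀ + σ * -(s ^ 2 / 4)) (by rw [add_sub_cancel_left, abs_mul, hσ1, hk, one_mul])
  have h5 : contactTime φ u (x₀ + σ * -(s ^ 2 / 4)) ≤ t + E * s ^ 3 := by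
    by_contra! hc
    have : 0 < E * s ^ 3 := by positivity
    exact h4.2.not_ge (h.le_of_lt_contactTime h4.1 (by linarith [ht.1]) hc)
  rw [hk] at h3
  have h6 := (abs_le.1 h3).1
  nlinarith [mul_lt_mul_of_pos_right hs4 (pow_pos hs 2)]

end IsThinFamily

namespace IsThinFamily

variable {θ κ η : ℝ} {φ : ℝ → ℝ} {u : ℝ → ℝ × ℝ → ℝ} {t : ℝ}

theorem false_of_quadratic (h : IsThinFamily θ κ η φ u) (hφ : IsC2Holder φ)
    (hgood : ∀ x ∈ Ioo (-1 : ℝ) 1, contactTime φ u x = t →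
      ∃ β ≠ 0, HasDerivAt (contactTime φ u) β x)
    {x₀ C ρ : ℝ} (ht : t ∈ Ioo (-1 : ℝ) 1) (hx₀ : x₀ ∈ Ioo (-1 : ℝ) 1) (hρ : 0 < ρ) (hC : 0 < C)
    (hc : u t (x₀, 0) = φ x₀)
    (hq : ∀ r ∈ Ioo 0 ρ, ∀ p : ℝ × ℝ, 0 ≤ p.2 → (p.1 - x₀) ^ 2 + p.2 ^ 2 < r ^ 2 →
      -(C * r ^ 2) ≤ u t p - φ p.1 - θ * p.2) : False := by
  have hx₀' : |x₀| < 1 := abs_lt.2 hx₀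
  have hq' : ∀ p : ℝ × ℝ, 0 ≤ p.2 → (p.1 - x₀) ^ 2 + p.2 ^ 2 < (ρ / 2) ^ 2 →
      -(4 * C * ((p.1 - x₀) ^ 2 + p.2 ^ 2)) ≤ u t p - φ p.1 - θ * p.2 := by
    intro p hp2 hp
    set R := (p.1 - x₀) ^ 2 + p.2 ^ 2 with hR
    have hR0 : 0 ≤ R := by positivity
    rcases hR0.eq_or_lt with h0 | h0
    · have h1 : p = (x₀, 0) := Prod.ext
        (by simp only; nlinarith [sq_nonneg p.2, sq_nonneg (p.1 - x₀)])
        (by simp only; nlinarith [sq_nonneg p.2, sq_nonneg (p.1 - x₀)])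
      rw [← h0, h1, hc]
      simp
    · have h1 := Real.sqrt_pos.2 h0
      have h2 : √R < ρ / 2 := (Real.sqrt_lt' (by positivity)).2 hp
      have h3 := hq (2 * √R) ⟨by positivity, by linarith⟩ p hp2
      rw [mul_pow, Real.sq_sqrt hR0] at h3
      linarith [h3 (by linarith)]
  have hb := h.contactTime_eq_of_quadratic ⟨ht.1.le, ht.2.le⟩ hx₀'.le (half_pos hρ) hc hq'
  obtain ⟨β, hβ, hd⟩ := hgood x₀ hx₀ hb
  rcases hβ.lt_or_gt with hβ | hβ
  · exact h.not_hasDerivAt_contactTime hφ (σ := 1) ht hx₀' (half_pos hρ)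
      (by positivity : 0 < 4 * C) (by norm_num) hq' hb (by linarith) hd
  · exact h.not_hasDerivAt_contactTime hφ (σ := -1) ht hx₀' (half_pos hρ)
      (by positivity : 0 < 4 * C) (by norm_num) hq' hb (by linarith) hd

theorem continuousAt_contactTime (h : IsThinFamily θ κ η φ u) (hφ : IsC2Holder φ)
    {x : ℝ} (hx : x ∈ Ioo (-1 : ℝ) 1) : ContinuousAt (contactTime φ u) x := by
  obtain ⟨K, ε, hε, hK⟩ := h.exists_lipschitzOnWith_contactTime hφ hx
  exact hK.continuousOn.continuousAt (Ioo_mem_nhds (by linarith) (by linarith))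

theorem eventually_contactTime_ne (h : IsThinFamily θ κ η φ u) (hφ : IsC2Holder φ)
    (hgood : ∀ x ∈ Ioo (-1 : ℝ) 1, contactTime φ u x = t →
      ∃ β ≠ 0, HasDerivAt (contactTime φ u) β x)
    {x : ℝ} (hx : x ∈ Ioo (-1 : ℝ) 1) : ∀ᶠ y in 𝓝[≠] x, contactTime φ u y ≠ t := by
  by_cases hxt : contactTime φ u x = t
  · obtain ⟨β, hβ, hd⟩ := hgood x hx hxt
    exact hd.eventually_ne hβ
  · exact ((h.continuousAt_contactTime hφ hx).eventually_ne hxt).filter_mono nhdsWithin_le_nhds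

theorem le_contactTime (ht : t ∈ Icc (-1 : ℝ) 1) {x : ℝ} (hx : u t (x, 0) ≤ φ x) :
    t ≤ contactTime φ u x :=
  le_csSup (bddAbove_contactTime_set φ u x) (Or.inr ⟨ht, hx⟩)

theorem contactTime_eq_or_of_mem_frontier (h : IsThinFamily θ κ η φ u) (hφ : IsC2Holder φ)
    (ht : t ∈ Ioo (-1 : ℝ) 1) {x : ℝ} (hx : x ∈ Ioo (-1 : ℝ) 1) (hxt : u t (x, 0) = φ x)
    (hcl : x ∈ closure {y | y ∈ Icc (-1 : ℝ) 1 ∧ u t (y, 0) ≠ φ y}) :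
    contactTime φ u x = t ∨
      contactTime (fun x => -φ x) (fun s p => -u (-s) p) x = -t := by
  have ht' : -t ∈ Icc (-1 : ℝ) 1 := ⟨by linarith [ht.2], by linarith [ht.1]⟩
  by_contra! hc
  have h1 := (le_contactTime ⟨ht.1.le, ht.2.le⟩ hxt.le).lt_of_ne' hc.1
  have h2 := (le_contactTime (u := fun s p => -u (-s) p) (φ := fun x => -φ x) (x := x) ht'
    (by simp [hxt])).lt_of_ne' hc.2
  have h3 := (h.continuousAt_contactTime hφ hx).eventually_const_lt h1
  have h4 := (h.neg.continuousAt_contactTime hφ.neg hx).eventually_const_lt h2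
  obtain ⟨y, ⟨hy1, hy2⟩, hy3, hy4⟩ := (mem_closure_iff_frequently.1 hcl).and_eventually (h3.and h4)
    |>.exists
  have h5 := h.le_of_lt_contactTime (abs_le.2 hy1) ht.1.le hy3
  have h6 := h.neg.le_of_lt_contactTime (abs_le.2 hy1) ht'.1 hy4
  simp only [neg_neg] at h6
  exact hy2 (by linarith)

theorem finite_frontier (h : IsThinFamily θ κ η φ u) (hφ : IsC2Holder φ)
    (ht : t ∈ Ioo (-1 : ℝ) 1)
    (hgood : ∀ x ∈ Ioo (-1 : ℝ) 1, contactTime φ u x = t →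
      ∃ β ≠ 0, HasDerivAt (contactTime φ u) β x)
    (hgood' : ∀ x ∈ Ioo (-1 : ℝ) 1, contactTime (fun x => -φ x) (fun s p => -u (-s) p) x = -t →
      ∃ β ≠ 0, HasDerivAt (contactTime (fun x => -φ x) (fun s p => -u (-s) p)) β x)
    (h1 : u t (1, 0) ≠ φ 1) (h2 : u t (-1, 0) ≠ φ (-1)) :
    (frontier {x | x ∈ Icc (-1 : ℝ) 1 ∧ u t (x, 0) ≠ φ x}).Finite := by
  set W := {x | x ∈ Icc (-1 : ℝ) 1 ∧ u t (x, 0) ≠ φ x} with hW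
  have hcl : closure W ⊆ Icc (-1) 1 := closure_minimal (fun x hx => hx.1) isClosed_Icc
  have hcont : ContinuousOn (fun x => u t (x, 0) - φ x) (Icc (-1) 1) := by
    refine ((h.sol t ⟨ht.1.le, ht.2.le⟩).continuousOn.comp (f := fun x : ℝ => (x, (0 : ℝ)))
      (by fun_prop) fun x hx => ⟨?_, le_rfl⟩).sub hφ.continuous.continuousOn
    simp only
    nlinarith [hx.1, hx.2]
  have hcontact : ∀ x ∈ Ioo (-1 : ℝ) 1, x ∈ frontier W → u t (x, 0) = φ x := by
    intro x hx hxF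
    by_contra hne
    have hc := hcont.continuousAt (Icc_mem_nhds hx.1 hx.2)
    refine hxF.2 (mem_interior_iff_mem_nhds.2 ?_)
    filter_upwards [hc.eventually_ne (sub_ne_zero.2 hne), Icc_mem_nhds hx.1 hx.2] with y hy hy'
    exact ⟨hy', sub_ne_zero.1 hy⟩
  by_contra hinf
  obtain ⟨x, hx, hacc⟩ := Set.Infinite.exists_accPt_of_subset_isCompact hinf isCompact_Icc
    (frontier_subset_closure.trans hcl)
  rw [accPt_iff_frequently_nhdsNE] at hacc
  by_cases hx' : x ∈ Ioo (-1 : ℝ) 1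
  · have e1 := h.eventually_contactTime_ne hφ hgood hx'
    have e2 := h.neg.eventually_contactTime_ne hφ.neg hgood' hx'
    have e3 : ∀ᶠ y in 𝓝[≠] x, y ∈ Ioo (-1 : ℝ) 1 :=
      nhdsWithin_le_nhds (Ioo_mem_nhds hx'.1 hx'.2)
    obtain ⟨y, hyF, hy1, hy2, hy3⟩ := (hacc.and_eventually (e1.and (e2.and e3))).exists
    rcases h.contactTime_eq_or_of_mem_frontier hφ ht hy3 (hcontact y hy3 hyF) hyF.1 with hy | hy
    · exact hy1 hy
    · exact hy2 hy
  · have hend : x = 1 ∨ x = -1 := by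
      by_contra! hne
      exact hx' ⟨lt_of_le_of_ne hx.1 hne.2.symm, lt_of_le_of_ne hx.2 hne.1⟩
    have hne : u t (x, 0) - φ x ≠ 0 := by
      rcases hend with rfl | rfl
      · exact sub_ne_zero.2 h1
      · exact sub_ne_zero.2 h2
    have e1 := eventually_nhdsWithin_iff.1 ((hcont x hx).eventually_ne hne)
    have e2 : ∀ᶠ y in 𝓝 x, (x = 1 → y ≠ -1) ∧ (x = -1 → y ≠ 1) := by
      rcases hend with rfl | rfl
      · filter_upwards [eventually_ne_nhds (show (1 : ℝ) ≠ -1 by norm_num)] with y hy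
        exact ⟨fun _ => hy, fun h => by norm_num at h⟩
      · filter_upwards [eventually_ne_nhds (show (-1 : ℝ) ≠ 1 by norm_num)] with y hy
        exact ⟨fun h => by norm_num at h, fun _ => hy⟩
    obtain ⟨y, hyF, ⟨hy1, hy2⟩, hyx⟩ := (hacc.and_eventually
      (((e1.and e2).filter_mono nhdsWithin_le_nhds).and self_mem_nhdsWithin)).exists
    have hyI := hcl hyF.1
    refine hy1 hyI (sub_eq_zero.2 (hcontact y ⟨lt_of_le_of_ne hyI.1 ?_, lt_of_le_of_ne hyI.2 ?_⟩ hyF))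
    · rintro rfl
      rcases hend with rfl | rfl
      · exact hy2.1 rfl rfl
      · exact hyx rfl
    · rintro rfl
      rcases hend with rfl | rfl
      · exact hyx rfl
      · exact hy2.2 rfl rfl

theorem ae_endpoint_ne (h : IsThinFamily θ κ η φ u) {σ : ℝ} (hσ : σ ^ 2 = 1) :
    ∀ᵐ t : ℝ, t ∈ Icc (-1 : ℝ) 1 → u t (σ, 0) ≠ φ σ := by
  have hs : {t | t ∈ Icc (-1 : ℝ) 1 ∧ u t (σ, 0) = φ σ}.Subsingleton := by
    rintro t ⟨ht, ht'⟩ s ⟨hs, hs'⟩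
    by_contra hne
    rcases lt_or_gt_of_ne hne with hlt | hlt
    · exact (h.endpoint_lt ht hs hlt hσ).ne (ht'.trans hs'.symm)
    · exact (h.endpoint_lt hs ht hlt hσ).ne (hs'.trans ht'.symm)
  filter_upwards [compl_mem_ae_iff.2 (hs.measure_zero volume)] with t ht hI he
  exact ht ⟨hI, he⟩

/-- Generic regularity for increasing families of solutions. -/
theorem ae_regular (h : IsThinFamily θ κ η φ u) (hφ : IsC2Holder φ) :
    ∀ᵐ t ∂(volume.restrict (Icc (-1 : ℝ) 1)), (∀ x₀ : ℝ, ¬SingPt θ φ (u t) x₀) ∧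
      (frontier {x | x ∈ Icc (-1 : ℝ) 1 ∧ u t (x, 0) ≠ φ x}).Finite := by
  have hneg := (Measure.measurePreserving_neg (volume : Measure ℝ)).quasiMeasurePreserving.ae
    (h.neg.ae_hasDerivAt_contactTime hφ.neg)
  rw [ae_restrict_iff' measurableSet_Icc]
  filter_upwards [h.ae_hasDerivAt_contactTime hφ, hneg, h.ae_endpoint_ne (σ := 1) (by norm_num),
    h.ae_endpoint_ne (σ := -1) (by norm_num), compl_mem_ae_iff.2 (measure_singleton (1 : ℝ)),
    compl_mem_ae_iff.2 (measure_singleton (-1 : ℝ))] with t g1 g2 g3 g4 g5 g6 ht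
  have ht' : t ∈ Ioo (-1 : ℝ) 1 := ⟨lt_of_le_of_ne ht.1 fun h => g6 h.symm, lt_of_le_of_ne ht.2 g5⟩
  refine ⟨?_, h.finite_frontier hφ ht' g1 g2 (g3 ht) (g4 ht)⟩
  rintro x₀ ⟨-, hc, rfl | rfl | ⟨ρ, hρ, hsub, C, hC, ⟨-, hq⟩ | ⟨-, hq⟩⟩⟩
  · exact g4 ht hc
  · exact g3 ht hc
  · have hx₀ : x₀ ∈ Ioo (-1 : ℝ) 1 := hsub ⟨by linarith, by linarith⟩
    refine h.false_of_quadratic hφ g1 ht' hx₀ hρ hC hc fun r hr p hp2 hp => ?_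
    have := (abs_le.1 (hq r hr p hp)).1
    rw [abs_of_nonneg hp2] at this
    linarith
  · have hx₀ : x₀ ∈ Ioo (-1 : ℝ) 1 := hsub ⟨by linarith, by linarith⟩
    refine h.neg.false_of_quadratic hφ.neg g2 ⟨by linarith [ht'.2], by linarith [ht'.1]⟩ hx₀ hρ hC
      (by simp [hc]) fun r hr p hp2 hp => ?_
    have := (abs_le.1 (hq r hr p hp)).2
    rw [abs_of_nonneg hp2] at this
    simp only [neg_neg]
    linarith

end IsThinFamily

theorem ContDiffAt.hasSecondDerivAt {f : ℝ → ℝ} {x : ℝ} (hf : ContDiffAt ℝ 2 f x) :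
    HasSecondDerivAt f (deriv (deriv f) x) x := by
  refine ⟨deriv f, ?_, ?_⟩
  · filter_upwards [hf.eventually (by simp)] with s hs
    exact (hs.differentiableAt (by norm_num)).hasDerivAt
  · have : ContDiffAt ℝ 1 (deriv f) x :=
      (hf.fderiv_right (m := 1) (by norm_num)).clm_apply contDiffAt_const
    exact (this.differentiableAt (by norm_num)).hasDerivAt

theorem HarmonicOn2.hasLaplacianAt {u : ℝ × ℝ → ℝ} {U : Set (ℝ × ℝ)} (hu : HarmonicOn2 u U)
    (hU : IsOpen U) {p : ℝ × ℝ} (hp : p ∈ U) : HasLaplacianAt u 0 p := by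
  have h := hu.1.contDiffAt (hU.mem_nhds hp)
  refine ⟨_, _, ContDiffAt.hasSecondDerivAt ?_, ContDiffAt.hasSecondDerivAt ?_, hu.2 p hp⟩
  · exact ContDiffAt.comp (g := u) (f := fun s => (s, p.2)) p.1 h (by fun_prop)
  · exact ContDiffAt.comp (g := u) (f := fun s => (p.1, s)) p.2 h (by fun_prop)

theorem isC2Holder_of_contDiff {φ : ℝ → ℝ} {α : ℝ} (hα : 0 < α) (hφ : ContDiff ℝ 2 φ)
    (hφholder : ∃ M : ℝ, ∀ x ∈ Icc (-1 : ℝ) 1, ∀ y ∈ Icc (-1 : ℝ) 1,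
      |iteratedDeriv 2 φ x - iteratedDeriv 2 φ y| ≤ M * |x - y| ^ α) : IsC2Holder φ := by
  obtain ⟨M, hM⟩ := hφholder
  refine ⟨deriv φ, iteratedDeriv 2 φ, α, M, hα, fun x => ?_, fun x => ?_,
    hφ.continuous_iteratedDeriv 2 le_rfl, hM⟩
  · exact (hφ.differentiable (by norm_num) x).hasDerivAt
  · rw [iteratedDeriv_succ, iteratedDeriv_one]
    have : ContDiff ℝ 1 (deriv φ) := by
      simpa using hφ.iterate_deriv' 1 1
    exact (this.differentiable (by norm_num) x).hasDerivAt

/-- **generic regularity for the two-phase thin obstacle problem.** Let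
`{u_t}` be a continuous, strictly increasing family of solutions of the two-phase thin
obstacle problem in `B₂ ⊂ ℝ²` with obstacle `φ ∈ C^{2,α}([−1,1])`. Then for a.e.
`t ∈ [−1,1]`: (i) `u_t` has no singular points; (ii) the free boundary
`∂{u_t(·,0) ≠ φ}` is a finite set. -/
theorem statement19
    (θ α : ℝ) (hθ : 0 < θ) (hα : 0 < α ∧ α ≤ 1)
    (φ : ℝ → ℝ) (hφ : ContDiff ℝ 2 φ)
    (hφholder : ∃ M : ℝ, ∀ x ∈ Set.Icc (-1:ℝ) 1, ∀ y ∈ Set.Icc (-1:ℝ) 1,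
      |iteratedDeriv 2 φ x - iteratedDeriv 2 φ y| ≤ M * |x - y| ^ α)
    (u : ℝ → ℝ × ℝ → ℝ)
    (hcont : ∀ t ∈ Set.Icc (-1:ℝ) 1, ContinuousOn (u t) {p : ℝ × ℝ | p.1^2 + p.2^2 ≤ 4})
    (heven : ∀ t ∈ Set.Icc (-1:ℝ) 1, ∀ p : ℝ × ℝ, u t (p.1, -p.2) = u t p)
    (hharm : ∀ t ∈ Set.Icc (-1:ℝ) 1,
      HarmonicOn2 (u t) {p : ℝ × ℝ | p.1^2 + p.2^2 < 4 ∧ p.2 ≠ 0})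
    (hbdry : ∀ t ∈ Set.Icc (-1:ℝ) 1, ∀ x₁ : ℝ, x₁^2 < 4 → ∃ L : ℝ,
      Filter.Tendsto (fun s => (u t (x₁, s) - u t (x₁, 0)) / s)
        (nhdsWithin 0 (Set.Ioi 0)) (nhds L) ∧
      (1 < |x₁| → L = θ) ∧
      (|x₁| ≤ 1 → |L| ≤ θ ∧
        (u t (x₁, 0) ≠ φ x₁ → L = θ * Real.sign (u t (x₁, 0) - φ x₁))))
    (hfamcont : ∀ t₀ ∈ Set.Icc (-1:ℝ) 1, ∀ ε > 0, ∃ δ > 0, ∀ t ∈ Set.Icc (-1:ℝ) 1,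
      |t - t₀| < δ → ∀ p : ℝ × ℝ, p.1^2 + p.2^2 ≤ 4 → |u t p - u t₀ p| ≤ ε)
    (η : ℝ) (hη : 0 < η)
    (hmono : ∀ t ∈ Set.Icc (-1:ℝ) 1, ∀ t' ∈ Set.Icc (-1:ℝ) 1, t < t' →
      ∀ p : ℝ × ℝ, p.1^2 + p.2^2 = 4 →
        (u t p ≤ u t' p ∧ (1 < |p.2| → u t p + η * (t' - t) ≤ u t' p))) :
    ∀ᵐ t ∂(volume.restrict (Set.Icc (-1:ℝ) 1)),
      (∀ x₀ : ℝ, ¬ SingPt θ φ (u t) x₀) ∧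
      (frontier {x₁ : ℝ | x₁ ∈ Set.Icc (-1:ℝ) 1 ∧ u t (x₁, 0) ≠ φ x₁}).Finite := by
  refine IsThinFamily.ae_regular (κ := θ) (η := η) ⟨hθ, hη, fun t ht => ⟨?_, ?_, ?_⟩, ?_⟩
    (isC2Holder_of_contDiff hα.1 hφ hφholder)
  · exact (hcont t ht).mono fun p hp => hp.1
  · have hopen : IsOpen {p : ℝ × ℝ | p.1 ^ 2 + p.2 ^ 2 < 4 ∧ p.2 ≠ 0} :=
      (isOpen_lt (f := fun p : ℝ × ℝ => p.1 ^ 2 + p.2 ^ 2) (by fun_prop) continuous_const).inter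
        (isOpen_ne_fun continuous_snd continuous_const)
    exact fun p hp hp2 => (hharm t ht).hasLaplacianAt hopen ⟨hp, hp2.ne'⟩
  · intro x hx
    obtain ⟨L, hL, h1, h2⟩ := hbdry t ht x hx
    refine ⟨L, hL, h1, fun hx1 => ⟨(h2 hx1).1, fun hlt => ?_, fun hlt => ?_⟩⟩
    · rw [(h2 hx1).2 hlt.ne', Real.sign_of_pos (by linarith), mul_one]
    · rw [(h2 hx1).2 hlt.ne, Real.sign_of_neg (by linarith), mul_neg_one]
  · intro t ht t' ht' htt p hp hp2
    have := hmono t ht t' ht' htt p hp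
    rwa [abs_of_nonneg hp2] at this
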